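/- arXiv:1111.1808 — 3 statements merged into one kernel-verified Lean document; each statement's English description precedes it below -/
import Mathlib

section
/- Let P ⊆ A be an inclusion of unital C*-algebras and suppose there exists a unital *-homomorphism β : A → P^∞ with β(x) = x for all x ∈ P (P embedded in P^∞ as constant sequences). Then every tracial state on P is the restriction to P of a tracial state on A; indeed, if τ ∈ T(P) and τ^∞ is the tracial state on P^∞ obtained by applying a Banach limit to (τ(x_n)) for a representing sequence (x_n), then τ^∞ ∘ β is a tracial state on A restricting to τ on P. -/
noncomputable section
set_option linter.unusedSectionVars false

open scoped ComplexOrder Matrix.Norms.L2Operator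
open Filter Topology

/-- An element of a `*`-ring is *positive* (in the C*-algebraic sense) if it has the
form `star y * y`. -/
def IsPosElem {R : Type*} [Mul R] [Star R] (a : R) : Prop :=
  ∃ y : R, a = star y * y

/-- A linear functional on a unital complex `*`-algebra is a *tracial state* if it is unital,
positive and tracial. -/
def IsTracialState {R : Type*} [Ring R] [StarRing R] [Module ℂ R] (τ : R →ₗ[ℂ] ℂ) : Prop :=
  τ 1 = 1 ∧ (∀ x : R, 0 ≤ τ (star x * x)) ∧ ∀ a b : R, τ (a * b) = τ (b * a)

/-- A linear map between complex `*`-algebras is *completely positive* if all of its matrix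
amplifications map positive elements to positive elements. -/
def IsCompletelyPositive {A B : Type*} [Ring A] [StarRing A] [Module ℂ A]
    [Ring B] [StarRing B] [Module ℂ B] (φ : A →ₗ[ℂ] B) : Prop :=
  ∀ (k : ℕ) (x : Matrix (Fin k) (Fin k) A), IsPosElem x → IsPosElem (x.map φ)

/-- A map has *order zero* on a subset if it preserves orthogonality there. -/
def OrderZeroOn {F D : Type*} [Mul F] [Zero F] [Mul D] [Zero D] (φ : F → D) (s : Set F) : Prop :=
  ∀ e ∈ s, ∀ f ∈ s, e * f = 0 → f * e = 0 → φ e * φ f = 0 ∧ φ f * φ e = 0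

/-- The finite-dimensional C*-algebra `⊕_{i=1}^s M_{r i}(ℂ)`. -/
abbrev FDBlock (s : ℕ) (r : Fin s → ℕ) : Type :=
  ∀ i : Fin s, Matrix (Fin (r i)) (Fin (r i)) ℂ

/-- The elements of `⊕_{i=1}^s M_{r i}(ℂ)` supported on the blocks with label `j`. -/
def blockSupp {s : ℕ} {r : Fin s → ℕ} {n : ℕ} (J : Fin s → Fin (n + 1)) (j : Fin (n + 1)) :
    Set (FDBlock s r) :=
  {x | ∀ i : Fin s, J i ≠ j → x i = 0}

/-- `DecompositionRankLE n D` : the C*-algebra `D` has decomposition rank at most `n`. -/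
def DecompositionRankLE (n : ℕ) (D : Type*) [NormedRing D] [StarRing D]
    [NormedAlgebra ℂ D] : Prop :=
  ∀ (S : Finset D) (ε : ℝ), 0 < ε →
    ∃ (s : ℕ) (r : Fin s → ℕ) (J : Fin s → Fin (n + 1))
      (ψ : D →ₗ[ℂ] FDBlock s r) (φ : FDBlock s r →ₗ[ℂ] D),
      IsCompletelyPositive ψ ∧ IsCompletelyPositive φ ∧
      (∀ a : D, ‖ψ a‖ ≤ ‖a‖) ∧ (∀ x : FDBlock s r, ‖φ x‖ ≤ ‖x‖) ∧
      (∀ j : Fin (n + 1), OrderZeroOn φ (blockSupp J j)) ∧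
      ∀ a ∈ S, ‖φ (ψ a) - a‖ < ε

/-- `NuclearDimensionLE n D` : the C*-algebra `D` has nuclear dimension at most `n`. -/
def NuclearDimensionLE (n : ℕ) (D : Type*) [NormedRing D] [StarRing D]
    [NormedAlgebra ℂ D] : Prop :=
  ∀ (S : Finset D) (ε : ℝ), 0 < ε →
    ∃ (s : ℕ) (r : Fin s → ℕ) (J : Fin s → Fin (n + 1))
      (ψ : D →ₗ[ℂ] FDBlock s r) (φ : FDBlock s r →ₗ[ℂ] D),
      IsCompletelyPositive ψ ∧ IsCompletelyPositive φ ∧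
      (∀ a : D, ‖ψ a‖ ≤ ‖a‖) ∧
      (∀ j : Fin (n + 1), (∀ x ∈ blockSupp J j, ‖φ x‖ ≤ ‖x‖) ∧
        OrderZeroOn φ (blockSupp J j)) ∧
      ∀ a ∈ S, ‖φ (ψ a) - a‖ < ε

/-- A bundled unital C*-algebra. -/
structure CStarAlg : Type 1 where
  carrier : Type
  [str : CStarAlgebra carrier]

attribute [instance] CStarAlg.str

/-- The *finite saturation* of a class `𝒞` of unital C*-algebras: the smallest class
containing `𝒞` which is closed under isomorphism, finite direct sums, matrix amplifications
and corners by nonzero projections. -/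
inductive FinSat (𝒞 : CStarAlg → Prop) : CStarAlg → Prop
  | base {B : CStarAlg} : 𝒞 B → FinSat 𝒞 B
  | iso {B B' : CStarAlg} : FinSat 𝒞 B → Nonempty (B'.carrier ≃⋆ₐ[ℂ] B.carrier) →
      FinSat 𝒞 B'
  | sum {B₁ B₂ B : CStarAlg} : FinSat 𝒞 B₁ → FinSat 𝒞 B₂ →
      Nonempty (B.carrier ≃⋆ₐ[ℂ] (B₁.carrier × B₂.carrier)) → FinSat 𝒞 B
  | matrix {B B' : CStarAlg} (k : ℕ) : FinSat 𝒞 B →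
      Nonempty (B'.carrier ≃⋆ₐ[ℂ] Matrix (Fin (k + 1)) (Fin (k + 1)) B.carrier) →
      FinSat 𝒞 B'
  | corner {B B' : CStarAlg} (p : B.carrier) : FinSat 𝒞 B → p ≠ 0 → p * p = p →
      star p = p →
      (∃ ι : B'.carrier →⋆ₙₐ[ℂ] B.carrier, Function.Injective ι ∧ ι 1 = p ∧
        Set.range ι = {x : B.carrier | p * x * p = x}) →
      FinSat 𝒞 B'

/-- `A` is a *unital local `𝒞`-algebra*. -/
def IsUnitalLocalAlg (𝒞 : CStarAlg → Prop) (A : Type*) [NormedRing A] [StarRing A]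
    [NormedAlgebra ℂ A] : Prop :=
  ∀ (S : Finset A) (ε : ℝ), 0 < ε →
    ∃ B : CStarAlg, FinSat 𝒞 B ∧
      ∃ φ : B.carrier →⋆ₐ[ℂ] A, ∀ a ∈ S, ∃ b : B.carrier, ‖a - φ b‖ < ε

/-- The class of separable unital C*-algebras with decomposition rank at most `n`. -/
def drClass (n : ℕ) : CStarAlg → Prop :=
  fun B => TopologicalSpace.SeparableSpace B.carrier ∧ DecompositionRankLE n B.carrier

/-- The class of separable unital C*-algebras with nuclear dimension at most `n`. -/
def nucClass (n : ℕ) : CStarAlg → Prop :=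
  fun B => TopologicalSpace.SeparableSpace B.carrier ∧ NuclearDimensionLE n B.carrier

/-- The class of separable unital C*-algebras with finite nuclear dimension. -/
def lnucClass : CStarAlg → Prop :=
  fun B => TopologicalSpace.SeparableSpace B.carrier ∧ ∃ n : ℕ, NuclearDimensionLE n B.carrier

/-- A separable unital C*-algebra has *locally finite nuclear dimension* if it is a
unital local `C_lnuc`-algebra. -/
def HasLocallyFiniteNuclearDimension (A : Type*) [NormedRing A] [StarRing A]
    [NormedAlgebra ℂ A] : Prop :=
  IsUnitalLocalAlg lnucClass A
/-! ### Group actions and the Rokhlin property -/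

/-- `α : G → (A →⋆ₐ[ℂ] A)` is an action of the group `G` on `A` by *-automorphisms. -/
def IsGroupAction {G A : Type*} [Group G] [CStarAlgebra A] (α : G → (A →⋆ₐ[ℂ] A)) : Prop :=
  (∀ a : A, α 1 a = a) ∧ ∀ (g h : G) (a : A), α g (α h a) = α (g * h) a

/-- The fixed point algebra `A^α` of an action, as a star subalgebra of `A`. -/
def fixedPointAlgebra {G A : Type*} [Group G] [CStarAlgebra A] (α : G → (A →⋆ₐ[ℂ] A)) :
    StarSubalgebra ℂ A where
  carrier := {a : A | ∀ g : G, α g a = a}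
  mul_mem' := fun {a} {b} ha hb g => by rw [map_mul, ha g, hb g]
  add_mem' := fun {a} {b} ha hb g => by rw [map_add, ha g, hb g]
  algebraMap_mem' := fun c g => by rw [AlgHomClass.commutes]
  star_mem' := fun {a} ha g => by rw [map_star, ha g]

/-- The Rokhlin property for a finite group action, expressed in terms of representing
sequences for projections in `A_∞ = (ℓ^∞(ℕ,A)/c₀(ℕ,A)) ∩ A'`. -/
def ActionHasRokhlin {G A : Type*} [Group G] [Fintype G] [CStarAlgebra A]
    (α : G → (A →⋆ₐ[ℂ] A)) : Prop :=
  ∃ e : G → ℕ → A,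
    (∀ g, ∃ M : ℝ, ∀ k, ‖e g k‖ ≤ M) ∧
    (∀ g, Tendsto (fun k => ‖e g k * e g k - e g k‖) atTop (𝓝 0)) ∧
    (∀ g, Tendsto (fun k => ‖star (e g k) - e g k‖) atTop (𝓝 0)) ∧
    (∀ g (a : A), Tendsto (fun k => ‖e g k * a - a * e g k‖) atTop (𝓝 0)) ∧
    Tendsto (fun k => ‖(∑ g : G, e g k) - 1‖) atTop (𝓝 0) ∧
    (∀ g h, Tendsto (fun k => ‖α g (e h k) - e (g * h) k‖) atTop (𝓝 0))

/-! ### Inclusions of unital C*-algebras, conditional expectations, Watatani index -/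

variable {P A : Type*}

/-- `E : A →ₗ[ℂ] P` is a conditional expectation onto the subalgebra `P` (included in `A`
via the injective unital *-homomorphism `ι`). -/
structure IsCondExpect [CStarAlgebra P] [CStarAlgebra A] (ι : P →⋆ₐ[ℂ] A)
    (E : A →ₗ[ℂ] P) : Prop where
  restricts : ∀ p : P, E (ι p) = p
  pos : ∀ x : A, IsPosElem (E (star x * x))
  bimodule : ∀ (p q : P) (x : A), E (ι p * x * ι q) = p * E x * q

/-- `{(u i, v i)}` is a quasi-basis for the conditional expectation `E`; the existence of a
quasi-basis says precisely that `E` is of index-finite type. -/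
def IsQuasiBasis [CStarAlgebra P] [CStarAlgebra A] (ι : P →⋆ₐ[ℂ] A) (E : A →ₗ[ℂ] P)
    {m : ℕ} (u v : Fin m → A) : Prop :=
  ∀ a : A, (a = ∑ i, u i * ι (E (v i * a))) ∧ (a = ∑ i, ι (E (a * u i)) * v i)

/-- The Rokhlin property for a conditional expectation of index-finite type with index
`ind = ∑ u i * v i` : there is a projection `e` in `A_∞ = (ℓ^∞(ℕ,A)/c₀(ℕ,A)) ∩ A'`
(given by a representing sequence) with `E^∞(e) = (Index E)⁻¹ · 1` such that `x ↦ x e`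
is injective on `A`. -/
def CondExpectHasRokhlin [CStarAlgebra P] [CStarAlgebra A] (ι : P →⋆ₐ[ℂ] A)
    (E : A →ₗ[ℂ] P) (ind : A) : Prop :=
  ∃ e : ℕ → A,
    (∃ M : ℝ, ∀ k, ‖e k‖ ≤ M) ∧
    Tendsto (fun k => ‖e k * e k - e k‖) atTop (𝓝 0) ∧
    Tendsto (fun k => ‖star (e k) - e k‖) atTop (𝓝 0) ∧
    (∀ a : A, Tendsto (fun k => ‖e k * a - a * e k‖) atTop (𝓝 0)) ∧
    (∃ w : A, w * ind = 1 ∧ ind * w = 1 ∧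
      Tendsto (fun k => ‖ι (E (e k)) - w‖) atTop (𝓝 0)) ∧
    (∀ x : A, Tendsto (fun k => ‖x * e k‖) atTop (𝓝 0) → x = 0)

/-! ### Cuntz comparison, dimension functions, strict comparison, almost divisibility -/

/-- Cuntz subequivalence for positive matrices over a C*-algebra (the topology on matrices
over a C*-algebra is the norm topology, which agrees with the product topology). -/
def CuntzSub {R : Type*} [NonUnitalNonAssocSemiring R] [Star R] [TopologicalSpace R]
    {m k : Type*} [Fintype m] [Fintype k] (a : Matrix m m R) (b : Matrix k k R) : Prop :=
  ∃ v : ℕ → Matrix m k R, Tendsto (fun j => v j * b * (v j).conjTranspose) atTop (𝓝 a)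

/-- `matNthRoot a j` is the (unique, if it exists) positive `j`-th root `a^{1/j}` of a
positive matrix `a` over a C*-algebra. -/
def matNthRoot {R : Type*} [Ring R] [StarRing R] {m : Type*} [Fintype m] [DecidableEq m]
    (a : Matrix m m R) (j : ℕ) : Matrix m m R :=
  open scoped Classical in
  if h : ∃ b : Matrix m m R, IsPosElem b ∧ b ^ j = a then h.choose else 0

/-- The standard extension `τ ⊗ Tr` of a functional `τ` to matrices. -/
def traceExt {R : Type*} [Ring R] [Module ℂ R] {m : Type*} [Fintype m]
    (τ : R →ₗ[ℂ] ℂ) (x : Matrix m m R) : ℂ :=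
  ∑ i, τ (x i i)

/-- The dimension function `d_τ(a) = lim_{n → ∞} τ(a^{1/n})` associated to a tracial
state `τ` (the limit exists, so it agrees with the `limsup` used here). -/
def dimFun {R : Type*} [Ring R] [StarRing R] [Module ℂ R] {m : Type*} [Fintype m]
    [DecidableEq m] (τ : R →ₗ[ℂ] ℂ) (a : Matrix m m R) : ℝ :=
  Filter.limsup (fun j : ℕ => (traceExt τ (matNthRoot a (j + 1))).re) atTop

/-- A unital C*-algebra `R` has *strict comparison* (of positive elements, with respect to
tracial states) if `d_τ(a) < d_τ(b)` for all tracial states `τ` implies `a ≾ b`. -/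
def HasStrictComparison (R : Type*) [Ring R] [StarRing R] [Module ℂ R]
    [TopologicalSpace R] : Prop :=
  ∀ (m k : ℕ) (a : Matrix (Fin m) (Fin m) R) (b : Matrix (Fin k) (Fin k) R),
    IsPosElem a → IsPosElem b →
    (∀ τ : R →ₗ[ℂ] ℂ, IsTracialState τ → dimFun τ a < dimFun τ b) →
    CuntzSub a b

/-- The Cuntz semigroup `W(R)` is *almost divisible*: for every positive contraction `a`
over `R` and every `k ≠ 0` there is `x = ⟨c⟩ ∈ W(R)` with `k ⬝ x ≤ ⟨a⟩ ≤ (k+1) ⬝ x`. -/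
def AlmostDivisible (R : Type*) [Ring R] [StarRing R] [TopologicalSpace R] : Prop :=
  ∀ (m : ℕ) (a : Matrix (Fin m) (Fin m) R),
    IsPosElem a → IsPosElem ((1 : Matrix (Fin m) (Fin m) R) - a) →
    ∀ k : ℕ, k ≠ 0 →
      ∃ (l : ℕ) (c : Matrix (Fin l) (Fin l) R), IsPosElem c ∧
        CuntzSub (Matrix.blockDiagonal fun _ : Fin k => c) a ∧
        CuntzSub a (Matrix.blockDiagonal fun _ : Fin (k + 1) => c)

/-- A unital C*-algebra is *pure* if it has strict comparison and almost divisible Cuntz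
semigroup. -/
def IsPure (R : Type*) [Ring R] [StarRing R] [Module ℂ R] [TopologicalSpace R] : Prop :=
  HasStrictComparison R ∧ AlmostDivisible R

/-- The order on projections over `R` is determined by traces. -/
def ProjOrderDeterminedByTraces (R : Type*) [Ring R] [StarRing R] [Module ℂ R] : Prop :=
  ∀ (k l : ℕ) (p : Matrix (Fin k) (Fin k) R) (q : Matrix (Fin l) (Fin l) R),
    p * p = p → star p = p → q * q = q → star q = q →
    (∀ τ : R →ₗ[ℂ] ℂ, IsTracialState τ → (traceExt τ p).re < (traceExt τ q).re) →
    ∃ v : Matrix (Fin l) (Fin k) R,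
      v.conjTranspose * v = p ∧ IsPosElem (q - v * v.conjTranspose)

/-- A unital C*-algebra has stable rank one if its invertible elements are dense. -/
def HasStableRankOne (R : Type*) [Ring R] [TopologicalSpace R] : Prop :=
  Dense {x : R | IsUnit x}

/-- A unital C*-algebra is simple if it has no nontrivial closed two-sided ideals. -/
def IsSimpleCStarAlgebra (A : Type*) [CStarAlgebra A] : Prop :=
  ∀ I : TwoSidedIdeal A, IsClosed (I : Set A) → I = ⊥ ∨ I = ⊤
/-! ### Corners `pRp` by a projection `p` -/

section CornerSection

variable {R : Type*} [Ring R] [StarRing R] [Algebra ℂ R] [StarModule ℂ R]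

/-- The corner `p R p` of a unital C*-algebra `R` by a projection `p`, as a unital
`*`-algebra with unit `p`. -/
def Corner (p : R) (_hp : p * p = p) (_hsp : star p = p) : Type _ :=
  {x : R // p * x * p = x}

namespace Corner

variable {p : R} {hp : p * p = p} {hsp : star p = p}

theorem mem_mul_left (hp : p * p = p) {x : R} (hx : p * x * p = x) : p * x = x := by
  conv_lhs => rw [← hx]
  simp only [← mul_assoc]
  rw [hp, hx]

theorem mem_mul_right (hp : p * p = p) {x : R} (hx : p * x * p = x) : x * p = x := by
  conv_lhs => rw [← hx]
  rw [mul_assoc, mul_assoc, hp, ← mul_assoc, hx]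

instance : Add (Corner p hp hsp) :=
  ⟨fun x y => ⟨x.1 + y.1, by rw [mul_add, add_mul, x.2, y.2]⟩⟩

instance : Zero (Corner p hp hsp) :=
  ⟨⟨0, by rw [mul_zero, zero_mul]⟩⟩

instance : Neg (Corner p hp hsp) :=
  ⟨fun x => ⟨-x.1, by rw [mul_neg, neg_mul, x.2]⟩⟩

instance : Mul (Corner p hp hsp) :=
  ⟨fun x y => ⟨x.1 * y.1, by
    rw [← mul_assoc p x.1 y.1, mem_mul_left hp x.2, mul_assoc x.1 y.1 p,
      mem_mul_right hp y.2]⟩⟩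

instance : One (Corner p hp hsp) :=
  ⟨⟨p, by rw [hp, hp]⟩⟩

instance : SMul ℂ (Corner p hp hsp) :=
  ⟨fun c x => ⟨c • x.1, by rw [mul_smul_comm, smul_mul_assoc, x.2]⟩⟩

instance : Star (Corner p hp hsp) :=
  ⟨fun x => ⟨star x.1, by
    conv_rhs => rw [← x.2]
    rw [star_mul, star_mul, hsp, ← mul_assoc]⟩⟩

@[simp] theorem val_add (x y : Corner p hp hsp) : (x + y).1 = x.1 + y.1 := rfl
@[simp] theorem val_mul (x y : Corner p hp hsp) : (x * y).1 = x.1 * y.1 := rfl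
@[simp] theorem val_zero : (0 : Corner p hp hsp).1 = 0 := rfl
@[simp] theorem val_one : (1 : Corner p hp hsp).1 = p := rfl
@[simp] theorem val_neg (x : Corner p hp hsp) : (-x).1 = -x.1 := rfl
@[simp] theorem val_smul (c : ℂ) (x : Corner p hp hsp) : (c • x).1 = c • x.1 := rfl
@[simp] theorem val_star (x : Corner p hp hsp) : (star x).1 = star x.1 := rfl

instance instRing : Ring (Corner p hp hsp) where
  add_assoc x y z := Subtype.ext <| by simp [add_assoc]
  zero_add x := Subtype.ext <| by simp
  add_zero x := Subtype.ext <| by simp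
  add_comm x y := Subtype.ext <| by simp [add_comm]
  neg_add_cancel x := Subtype.ext <| by simp
  nsmul := nsmulRec
  zsmul := zsmulRec
  mul_assoc x y z := Subtype.ext <| by simp [mul_assoc]
  one_mul x := Subtype.ext <| by simpa using mem_mul_left hp x.2
  mul_one x := Subtype.ext <| by simpa using mem_mul_right hp x.2
  left_distrib x y z := Subtype.ext <| by simp [left_distrib]
  right_distrib x y z := Subtype.ext <| by simp [right_distrib]
  zero_mul x := Subtype.ext <| by simp
  mul_zero x := Subtype.ext <| by simp

instance instStarRing : StarRing (Corner p hp hsp) where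
  star_involutive x := Subtype.ext <| by simp
  star_mul x y := Subtype.ext <| by simp
  star_add x y := Subtype.ext <| by simp

instance instModule : Module ℂ (Corner p hp hsp) where
  one_smul x := Subtype.ext <| by simp
  mul_smul c d x := Subtype.ext <| by simp [mul_smul]
  smul_zero c := Subtype.ext <| by simp
  smul_add c x y := Subtype.ext <| by simp
  add_smul c d x := Subtype.ext <| by simp [add_smul]
  zero_smul x := Subtype.ext <| by simp

instance instTop [TopologicalSpace R] : TopologicalSpace (Corner p hp hsp) :=
  instTopologicalSpaceSubtype

end Corner

end CornerSection

/-! ### Sequence algebras: `A^∞ = ℓ^∞(ℕ, A)/c₀(ℕ, A)` via representing sequences -/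

/-- A sequence in a normed space is null (i.e. lies in `c₀(ℕ, A)`). -/
def IsNullSeq {A : Type*} [Norm A] (x : ℕ → A) : Prop :=
  Tendsto (fun n => ‖x n‖) atTop (𝓝 0)

/-- A sequence in a normed space is bounded (i.e. lies in `ℓ^∞(ℕ, A)`). -/
def IsBddSeq {A : Type*} [Norm A] (x : ℕ → A) : Prop :=
  ∃ M : ℝ, ∀ n, ‖x n‖ ≤ M

/-- A linear map `β : A →ₗ[ℂ] ℓ^∞(ℕ, P)` represents a unital *-homomorphism
`A → P^∞ = ℓ^∞(ℕ, P)/c₀(ℕ, P)` : it takes values in bounded sequences and is unital,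
multiplicative and star-preserving modulo `c₀(ℕ, P)`. -/
structure RepresentsHomToSeqAlg {A P : Type*} [CStarAlgebra A] [CStarAlgebra P]
    (β : A →ₗ[ℂ] (ℕ → P)) : Prop where
  bdd : ∀ x : A, IsBddSeq (β x)
  unital : IsNullSeq (β 1 - 1)
  mul : ∀ x y : A, IsNullSeq (β (x * y) - β x * β y)
  star : ∀ x : A, IsNullSeq (β (star x) - star (β x))

/-- A Banach limit: a linear functional on (bounded) complex sequences which is unital,
shift-invariant, positive and bounded. -/
structure IsBanachLimit (L : (ℕ → ℂ) →ₗ[ℂ] ℂ) : Prop where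
  unital : L 1 = 1
  shift : ∀ x : ℕ → ℂ, IsBddSeq x → L (fun n => x (n + 1)) = L x
  pos : ∀ x : ℕ → ℂ, IsBddSeq x → (∀ n, 0 ≤ x n) → 0 ≤ L x
  norm_le : ∀ (x : ℕ → ℂ) (M : ℝ), (∀ n, ‖x n‖ ≤ M) → ‖L x‖ ≤ M

/-- A C*-algebra is *exact* iff it is nuclearly embeddable (Kirchberg): it admits a faithful
representation `π : A → B(H)` which approximately factors through matrix algebras by
completely positive contractions in the point-norm topology. -/
def IsExactCStar (A : Type*) [CStarAlgebra A] : Prop :=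
  ∃ (H : Type) (_ : NormedAddCommGroup H) (_ : InnerProductSpace ℂ H) (_ : CompleteSpace H)
    (π : A →⋆ₐ[ℂ] (H →L[ℂ] H)), Function.Injective π ∧
      ∀ (S : Finset A) (ε : ℝ), 0 < ε →
        ∃ (k : ℕ) (ψ : A →ₗ[ℂ] Matrix (Fin k) (Fin k) ℂ)
          (φ : Matrix (Fin k) (Fin k) ℂ →ₗ[ℂ] (H →L[ℂ] H)),
          IsCompletelyPositive ψ ∧ IsCompletelyPositive φ ∧
          (∀ a : A, ‖ψ a‖ ≤ ‖a‖) ∧ (∀ x, ‖φ x‖ ≤ ‖x‖) ∧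
          ∀ a ∈ S, ‖φ (ψ a) - π a‖ < ε

theorem aux_bound {P : Type} [CStarAlgebra P] (τ : P →ₗ[ℂ] ℂ) (hτ : IsTracialState τ) :
    ∃ C : ℝ, 0 ≤ C ∧ ∀ p, ‖τ p‖ ≤ C * ‖p‖ := by
  letI := CStarAlgebra.spectralOrder P
  haveI := CStarAlgebra.spectralOrderedRing P
  have hpos : ∀ x : P, 0 ≤ x → 0 ≤ τ x := by
    intro x hx
    obtain ⟨y, rfl⟩ := CStarAlgebra.nonneg_iff_eq_star_mul_self.mp hx
    exact hτ.2.1 y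
  obtain ⟨C, hC⟩ := PositiveLinearMap.exists_norm_apply_le (PositiveLinearMap.mk₀ τ hpos)
  exact ⟨C, C.2, hC⟩

theorem aux_null_bdd {A : Type} [SeminormedAddCommGroup A] {x : ℕ → A} (h : IsNullSeq x) :
    IsBddSeq x := by
  obtain ⟨M, hM⟩ := h.bddAbove_range
  exact ⟨M, fun n => hM ⟨n, rfl⟩⟩

theorem aux_core (P A : Type) [CStarAlgebra P] [CStarAlgebra A]
    (ι : P →⋆ₐ[ℂ] A)
    (β : A →ₗ[ℂ] (ℕ → P)) (hβ : RepresentsHomToSeqAlg β)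
    (hβP : ∀ p : P, IsNullSeq (β (ι p) - fun _ => p))
    (τ : P →ₗ[ℂ] ℂ) (hτ : IsTracialState τ) (L : (ℕ → ℂ) →ₗ[ℂ] ℂ)
    (h1 : L 1 = 1) (h0 : ∀ x : ℕ → ℂ, IsNullSeq x → L x = 0)
    (hp : ∀ x : ℕ → ℂ, IsBddSeq x → (∀ n, 0 ≤ x n) → 0 ≤ L x) :
      IsTracialState (L.comp ((LinearMap.compLeft τ ℕ).comp β)) ∧
      ∀ p : P, (L.comp ((LinearMap.compLeft τ ℕ).comp β)) (ι p) = τ p := by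
  obtain ⟨C, hC0, hC⟩ := aux_bound τ hτ
  have key : ∀ x y : ℕ → P, IsNullSeq (x - y) →
      L (LinearMap.compLeft τ ℕ x) = L (LinearMap.compLeft τ ℕ y) := by
    intro x y h
    rw [← sub_eq_zero, ← map_sub, ← map_sub]
    apply h0
    have h' : Tendsto (fun n => C * ‖(x - y) n‖) atTop (𝓝 0) := by
      simpa using h.const_mul C
    exact squeeze_zero (fun n => norm_nonneg _) (fun n => hC _) h'
  have hconst : ∀ p : P, L (LinearMap.compLeft τ ℕ (fun _ => p)) = τ p := by
    intro p
    have : (LinearMap.compLeft τ ℕ (fun _ => p)) = τ p • (1 : ℕ → ℂ) := by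
      ext n; simp
    rw [this, map_smul, h1]; simp
  refine ⟨⟨?_, ?_, ?_⟩, ?_⟩
  · have := key _ _ hβ.unital
    simp only [LinearMap.comp_apply]
    rw [this]
    exact (hconst 1).trans hτ.1
  · intro x
    simp only [LinearMap.comp_apply]
    have hn : IsNullSeq (β (star x * x) - star (β x) * β x) := by
      obtain ⟨M, hM⟩ := hβ.bdd x
      have h2 := (hβ.mul (star x) x).add ((hβ.star x).mul_const M)
      simp only [zero_mul, add_zero] at h2
      refine squeeze_zero (fun n => norm_nonneg _) (fun n => ?_) h2
      have e : (β (star x * x) - star (β x) * β x) n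
          = (β (star x * x) - β (star x) * β x) n + (β (star x) - star (β x)) n * β x n := by
        simp [sub_mul]
      rw [e]
      refine (norm_add_le _ _).trans ?_
      gcongr
      refine (norm_mul_le _ _).trans ?_
      gcongr
      exact hM n
    rw [key _ _ hn]
    apply hp
    · obtain ⟨M, hM⟩ := hβ.bdd x
      refine ⟨C * (M * M), fun n => (hC _).trans ?_⟩
      have hM0 : 0 ≤ M := (norm_nonneg _).trans (hM n)
      gcongr
      refine (norm_mul_le _ _).trans ?_
      have := hM n
      gcongr
      simpa using this
    · intro n
      exact hτ.2.1 (β x n)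
  · intro a b
    simp only [LinearMap.comp_apply]
    rw [key _ _ (hβ.mul a b), key _ _ (hβ.mul b a)]
    congr 1
    ext n
    exact hτ.2.2 _ _
  · intro p
    simp only [LinearMap.comp_apply]
    rw [key _ _ (hβP p), hconst]

theorem aux_banach_null (L : (ℕ → ℂ) →ₗ[ℂ] ℂ) (hL : IsBanachLimit L) (x : ℕ → ℂ)
    (hx : IsNullSeq x) : L x = 0 := by
  have hshift : ∀ N : ℕ, L (fun n => x (n + N)) = L x := by
    intro N
    induction N with
    | zero => rfl
    | succ k ih =>
      rw [← ih, ← hL.shift (fun n => x (n + k))]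
      · congr 1; ext n; congr 1; ring
      · obtain ⟨M, hM⟩ := aux_null_bdd hx
        exact ⟨M, fun n => hM _⟩
  rw [← norm_le_zero_iff]
  refine le_of_forall_pos_le_add fun ε hε => ?_
  rw [zero_add]
  obtain ⟨N, hN⟩ := eventually_atTop.mp (hx.eventually (ge_mem_nhds hε))
  rw [← hshift N]
  exact hL.norm_le _ _ fun n => hN _ (Nat.le_add_left _ _)

theorem aux_ulim (x : ℕ → ℂ) (hx : IsBddSeq x) :
    ∃ l, Tendsto x (hyperfilter ℕ) (𝓝 l) := by
  obtain ⟨M, hM⟩ := hx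
  have hc : IsCompact (Metric.closedBall (0 : ℂ) M) := isCompact_closedBall _ _
  obtain ⟨l, -, hl⟩ := hc.ultrafilter_le_nhds ((hyperfilter ℕ).map x) (by
    rw [le_principal_iff]
    exact Filter.mem_map.mpr (Filter.univ_mem' fun n => by simpa using hM n))
  exact ⟨l, hl⟩

theorem aux_exists : ∃ L : (ℕ → ℂ) →ₗ[ℂ] ℂ, L 1 = 1 ∧
    (∀ x : ℕ → ℂ, IsNullSeq x → L x = 0) ∧
    (∀ x : ℕ → ℂ, IsBddSeq x → (∀ n, 0 ≤ x n) → 0 ≤ L x) := by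
  let S : Submodule ℂ (ℕ → ℂ) :=
    { carrier := {x | IsBddSeq x}
      add_mem' := by
        rintro a b ⟨M, hM⟩ ⟨N, hN⟩
        exact ⟨M + N, fun n => (norm_add_le _ _).trans (add_le_add (hM n) (hN n))⟩
      zero_mem' := ⟨0, fun n => by simp⟩
      smul_mem' := by
        rintro c a ⟨M, hM⟩
        refine ⟨‖c‖ * M, fun n => ?_⟩
        rw [Pi.smul_apply, norm_smul]
        exact mul_le_mul_of_nonneg_left (hM n) (norm_nonneg _) }
  choose f hf using fun x : S => aux_ulim x.1 x.2
  let F : S →ₗ[ℂ] ℂ :=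
    { toFun := f
      map_add' := fun a b => tendsto_nhds_unique (hf (a + b)) ((hf a).add (hf b))
      map_smul' := fun c a => tendsto_nhds_unique (hf (c • a)) ((hf a).const_smul c) }
  obtain ⟨L, hL⟩ := F.exists_extend
  have hLS : ∀ x (hx : IsBddSeq x), Tendsto x (hyperfilter ℕ) (𝓝 (L x)) := by
    intro x hx
    have h2 : L x = f ⟨x, hx⟩ := LinearMap.congr_fun hL ⟨x, hx⟩
    rw [h2]
    exact hf ⟨x, hx⟩
  refine ⟨L, ?_, ?_, ?_⟩
  · exact tendsto_nhds_unique (hLS 1 ⟨1, fun n => by simp⟩) tendsto_const_nhds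
  · intro x hx
    exact tendsto_nhds_unique (hLS x (aux_null_bdd hx))
      ((tendsto_zero_iff_norm_tendsto_zero.mpr hx).mono_left Nat.hyperfilter_le_atTop)
  · intro x hx h
    exact ge_of_tendsto' (hLS x hx) h

theorem stmt10 (P A : Type) [CStarAlgebra P] [CStarAlgebra A]
    (ι : P →⋆ₐ[ℂ] A) (hι : Function.Injective ι)
    (β : A →ₗ[ℂ] (ℕ → P)) (hβ : RepresentsHomToSeqAlg β)
    (hβP : ∀ p : P, IsNullSeq (β (ι p) - fun _ => p)) :
    (∀ τ : P →ₗ[ℂ] ℂ, IsTracialState τ → ∀ L : (ℕ → ℂ) →ₗ[ℂ] ℂ, IsBanachLimit L →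
      IsTracialState (L.comp ((LinearMap.compLeft τ ℕ).comp β)) ∧
      ∀ p : P, (L.comp ((LinearMap.compLeft τ ℕ).comp β)) (ι p) = τ p) ∧
    (∀ τ : P →ₗ[ℂ] ℂ, IsTracialState τ →
      ∃ T : A →ₗ[ℂ] ℂ, IsTracialState T ∧ ∀ p : P, T (ι p) = τ p) := by
  refine ⟨fun τ hτ L hL => aux_core P A ι β hβ hβP τ hτ L hL.unital
    (aux_banach_null L hL) hL.pos, fun τ hτ => ?_⟩
  obtain ⟨L, h1, h0, hp⟩ := aux_exists
  exact ⟨_, aux_core P A ι β hβ hβP τ hτ L h1 h0 hp⟩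

end
end

section
/- Let A be a unital C*-algebra such that the order on projections over A is determined by traces, let P ⊆ A be an inclusion of unital C*-algebras, and let E : A → P be a conditional expectation of index finite type with the Rokhlin property. Then the order on projections over P is determined by traces. -/
noncomputable section
set_option linter.unusedSectionVars false

open scoped ComplexOrder Matrix.Norms.L2Operator
open Filter Topology

/-! ### Inclusions of unital C*-algebras, conditional expectations, Watatani index -/

variable {P A : Type*}

lemma aux_negPart {M : Type*} [CStarAlgebra M] [PartialOrder M] [StarOrderedRing M] (G : M)
    (hG : IsSelfAdjoint G) : ∃ H N S : M, star H = H ∧ star N = N ∧ star S = S ∧ 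
      S * S = N ∧ G = H * H - N ∧ H * H * N = 0 := by
  refine ⟨CFC.sqrt G⁺, G⁻, CFC.sqrt G⁻, ?_, ?_, ?_, ?_, ?_, ?_⟩
  · exact (CFC.sqrt_nonneg _).isSelfAdjoint
  · exact (CFC.negPart_nonneg G).isSelfAdjoint
  · exact (CFC.sqrt_nonneg _).isSelfAdjoint
  · exact CFC.sqrt_mul_sqrt_self _ (CFC.negPart_nonneg G)
  · rw [CFC.sqrt_mul_sqrt_self _ (CFC.posPart_nonneg G)]
    exact (CFC.posPart_sub_negPart G hG).symm
  · rw [CFC.sqrt_mul_sqrt_self _ (CFC.posPart_nonneg G)]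
    exact CFC.posPart_mul_negPart G

lemma aux_mat {P : Type*} [CStarAlgebra P] [PartialOrder P] [StarOrderedRing P] {m : ℕ}
    (G : Matrix (Fin m) (Fin m) P) (hG : star G = G) : 
    ∃ H N S : Matrix (Fin m) (Fin m) P, star H = H ∧ star N = N ∧ star S = S ∧ 
      S * S = N ∧ G = H * H - N ∧ H * H * N = 0 :=
  aux_negPart (M := CStarMatrix (Fin m) (Fin m) P) G hG

lemma aux_colzero {P : Type*} [CStarAlgebra P] [PartialOrder P] [StarOrderedRing P] {m l : Type*} 
    [Fintype m] [Fintype l]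
    (G : Matrix m l P) (hG : ∀ j, (G.conjTranspose * G) j j ≤ 0) : G = 0 := by
  ext i j
  have h := hG j
  simp only [Matrix.mul_apply, Matrix.conjTranspose_apply] at h
  have h0 : ∀ k ∈ Finset.univ, 0 ≤ star (G k j) * G k j := fun k _ => star_mul_self_nonneg _
  have h1 := (Finset.sum_eq_zero_iff_of_nonneg h0).1 (le_antisymm h (Finset.sum_nonneg h0)) i (Finset.mem_univ _)
  exact (CStarRing.star_mul_self_eq_zero_iff _).1 h1

lemma aux_factor {P : Type*} [CStarAlgebra P] [PartialOrder P] [StarOrderedRing P] {m : ℕ}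
    (G : Matrix (Fin m) (Fin m) P) (hG : star G = G)
    (hpos : ∀ c : Fin m → P, 0 ≤ ∑ i, ∑ k, star (c i) * G i k * c k) : 
    ∃ H : Matrix (Fin m) (Fin m) P, star H = H ∧ G = H * H := by
  obtain ⟨H, N, S, hH, hN, hS, hSN, hd, ho⟩ := aux_mat G hG
  refine ⟨H, hH, ?_⟩
  have h1 : N * G * N = - (star (S * N) * (S * N)) := by
    rw [hd, star_mul, hN, hS]
    have : N * (H * H - N) * N = N * (H * H * N) - N * N * N := by noncomm_ring
    rw [this, ho, mul_zero, zero_sub]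
    congr 1
    calc N * N * N = N * (S * S) * N := by rw [hSN]
      _ = _ := by noncomm_ring
  have h2 : S * N = 0 := by
    apply aux_colzero
    intro j
    have h3 := congrFun (congrFun h1 j) j
    have h4 : (N * G * N) j j = ∑ i, ∑ k, star (N i j) * G i k * N k j := by
      simp only [Matrix.mul_apply, Finset.sum_mul]
      rw [Finset.sum_comm]
      refine Finset.sum_congr rfl fun i _ => Finset.sum_congr rfl fun k _ => ?_
      rw [← Matrix.star_apply, hN]
    have h5 := hpos (fun i => N i j)
    rw [← h4, h3] at h5
    exact neg_nonneg.1 h5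
  have h6 : star N * N = 0 := by rw [hN]; nth_rw 1 [← hSN]; rw [mul_assoc, h2, mul_zero]
  have h7 : N = 0 := by
    apply aux_colzero
    intro j
    have := congrFun (congrFun h6 j) j
    exact this.le
  rw [hd, h7, sub_zero]

open scoped Pointwise in
lemma aux_invsqrt {M : Type*} [CStarAlgebra M] [PartialOrder M] [StarOrderedRing M] (c : M)
    (hc : star c = c) (h1 : ‖c - 1‖ < 1) : ∃ d : M, star d = d ∧ d * c * d = 1 ∧ 
      ∀ p : M, p * c = c * p → p * d = d * p := by
  have hu : IsUnit c := by
    have := (Units.oneSub (1 - c) (by rwa [norm_sub_rev])).isUnit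
    simpa using this
  have hsp : ∀ x ∈ spectrum ℝ c, 0 < x := by
    intro x hx
    have h2 : x - 1 ∈ spectrum ℝ (c - 1) := by
      have := spectrum.sub_singleton_eq c (1:ℝ)
      have h3 : x - 1 ∈ spectrum ℝ c - {(1:ℝ)} := Set.sub_mem_sub hx rfl
      rw [spectrum.sub_singleton_eq] at h3
      simpa using h3
    by_cases hn : Nontrivial M
    · have := spectrum.norm_le_norm_of_mem h2
      have h4 := lt_of_le_of_lt this h1
      rw [Real.norm_eq_abs, abs_lt] at h4
      linarith
    · rw [not_nontrivial_iff_subsingleton] at hn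
      simp [spectrum.of_subsingleton] at hx
  have hcont : ContinuousOn (fun x : ℝ => (Real.sqrt x)⁻¹) (spectrum ℝ c) := by
    apply ContinuousOn.inv₀ (by fun_prop)
    intro x hx
    exact (Real.sqrt_pos.2 (hsp x hx)).ne'
  refine ⟨cfc (fun x : ℝ => (Real.sqrt x)⁻¹) c, ?_, ?_, ?_⟩
  · exact (cfc_predicate (R := ℝ) _ c : IsSelfAdjoint _)
  · have hid : cfc (fun x : ℝ => x) c = c := cfc_id' ℝ c (show IsSelfAdjoint c from hc)
    nth_rw 2 [← hid]
    rw [← cfc_mul (R := ℝ) .., ← cfc_mul (R := ℝ) ..]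
    rw [← cfc_one ℝ c (show IsSelfAdjoint c from hc)]
    apply cfc_congr
    intro x hx
    have := hsp x hx
    have h5 : Real.sqrt x * Real.sqrt x = x := Real.mul_self_sqrt this.le
    have h6 := (Real.sqrt_pos.2 this).ne'
    simp only [Pi.one_apply]
    field_simp
    nlinarith
  · intro p hp
    exact (Commute.cfc_real (show Commute c p from hp.symm) _).symm

lemma aux_invsqrt_mat {P : Type*} [CStarAlgebra P] [PartialOrder P] [StarOrderedRing P] {m : ℕ}
    (c : ℕ → Matrix (Fin m) (Fin m) P) (hc : ∀ n, star (c n) = c n)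
    (ht : ∀ i j, Tendsto (fun n => c n i j) atTop (𝓝 ((1 : Matrix (Fin m) (Fin m) P) i j))) :
    ∃ n, ∃ d : Matrix (Fin m) (Fin m) P, star d = d ∧ d * c n * d = 1 ∧ 
      ∀ p, p * c n = c n * p → p * d = d * p := by
  have h1 : Tendsto (β := CStarMatrix (Fin m) (Fin m) P) c atTop 
     (𝓝 (1 : CStarMatrix (Fin m) (Fin m) P)) := by
    have : Tendsto c atTop (𝓝 (1 : Matrix (Fin m) (Fin m) P)) :=
      tendsto_pi_nhds.2 fun i => tendsto_pi_nhds.2 fun j => ht i j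
    exact this
  have h2 := ((tendsto_iff_norm_sub_tendsto_zero (E := CStarMatrix (Fin m) (Fin m) P)).1 h1).eventually (gt_mem_nhds one_pos)
  obtain ⟨n, hn⟩ := h2.exists
  exact ⟨n, aux_invsqrt (M := CStarMatrix (Fin m) (Fin m) P) (c n) (hc n) hn⟩

/-- bounded sequences -/
def BSeq (A : Type*) [NormedRing A] : Subring (ℕ → A) where
  carrier := {x | ∃ M : ℝ, ∀ n, ‖x n‖ ≤ M}
  mul_mem' := by
    rintro x y ⟨M, hM⟩ ⟨N, hN⟩
    refine ⟨M * N, fun n => (norm_mul_le _ _).trans ?_⟩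
    exact mul_le_mul (hM n) (hN n) (norm_nonneg _) ((norm_nonneg _).trans (hM n))
  add_mem' := by
    rintro x y ⟨M, hM⟩ ⟨N, hN⟩
    exact ⟨M + N, fun n => (norm_add_le _ _).trans (add_le_add (hM n) (hN n))⟩
  one_mem' := ⟨‖(1 : A)‖, fun n => le_rfl⟩
  zero_mem' := ⟨0, fun n => by simp⟩
  neg_mem' := by
    rintro x ⟨M, hM⟩
    exact ⟨M, fun n => by simpa using hM n⟩

/-- congruence modulo null sequences -/
def nullCon (A : Type*) [NormedRing A] : RingCon (BSeq A) where
  r x y := Tendsto (fun n => x.1 n - y.1 n) atTop (𝓝 0)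
  iseqv := by
    refine ⟨fun x => by simp, fun {x y} h => ?_, fun {x y z} h1 h2 => ?_⟩
    · simpa using h.neg
    · simpa using h1.add h2
  add' := by
    intro w x y z h1 h2
    have := h1.add h2
    rw [add_zero] at this
    refine this.congr fun n => ?_
    simp only [Subring.coe_add, Pi.add_apply]
    abel
  mul' := by
    intro w x y z h1 h2
    obtain ⟨M, hM⟩ := x.2
    obtain ⟨N, hN⟩ := y.2
    have e1 : Tendsto (fun n => (w.1 n - x.1 n) * y.1 n) atTop (𝓝 0) := by
      rw [tendsto_zero_iff_norm_tendsto_zero] at h1 ⊢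
      refine squeeze_zero (fun n => norm_nonneg _) (fun n => ?_) (by simpa using h1.mul_const N)
      exact (norm_mul_le _ _).trans (mul_le_mul_of_nonneg_left (hN n) (norm_nonneg _))
    have e2 : Tendsto (fun n => x.1 n * (y.1 n - z.1 n)) atTop (𝓝 0) := by
      rw [tendsto_zero_iff_norm_tendsto_zero] at h2 ⊢
      refine squeeze_zero (fun n => norm_nonneg _) (fun n => ?_) (by simpa using h2.const_mul M)
      exact (norm_mul_le _ _).trans (mul_le_mul_of_nonneg_right (hM n) (norm_nonneg _))
    have := e1.add e2
    rw [add_zero] at this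
    refine this.congr fun n => ?_
    simp only [Subring.coe_mul, Pi.mul_apply]
    noncomm_ring

/-- the sequence algebra -/
abbrev SQ (A : Type*) [NormedRing A] := (nullCon A).Quotient

/-- quotient map -/
def qmk (A : Type*) [NormedRing A] : BSeq A →+* SQ A := (nullCon A).mk'

lemma qmk_surj {A : Type*} [NormedRing A] (x : SQ A) : ∃ y, qmk A y = x := 
  RingCon.mk'_surjective _ x

/-- a section -/
def qsec {A : Type*} [NormedRing A] (x : SQ A) : BSeq A := (qmk_surj x).choose

lemma qmk_qsec {A : Type*} [NormedRing A] (x : SQ A) : qmk A (qsec x) = x :=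
  (qmk_surj x).choose_spec

lemma qmk_eq {A : Type*} [NormedRing A] (x y : BSeq A) : 
    qmk A x = qmk A y ↔ Tendsto (fun n => x.1 n - y.1 n) atTop (𝓝 0) := by
  exact RingCon.eq (nullCon A)

/-- constant sequences -/
def qconst (A : Type*) [NormedRing A] : A →+* BSeq A where
  toFun a := ⟨fun _ => a, ‖a‖, fun _ => le_rfl⟩
  map_one' := rfl
  map_mul' _ _ := rfl
  map_zero' := rfl
  map_add' _ _ := rfl

/-- coordinatewise map -/
def bmap {A B : Type*} [NormedRing A] [NormedRing B] (f : A →+ B) (C : ℝ)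
    (hf : ∀ a, ‖f a‖ ≤ C * ‖a‖) : BSeq A →+ BSeq B where
  toFun x := ⟨fun n => f (x.1 n), by
    obtain ⟨M, hM⟩ := x.2
    refine ⟨|C| * M, fun n => (hf _).trans ?_⟩
    refine (mul_le_mul_of_nonneg_right (le_abs_self C) (norm_nonneg _)).trans ?_
    exact mul_le_mul_of_nonneg_left (hM n) (abs_nonneg _)⟩
  map_zero' := by ext n; simp
  map_add' x y := by ext n; simp

lemma bmap_congr {A B : Type*} [NormedRing A] [NormedRing B] (f : A →+ B) (C : ℝ)
    (hf : ∀ a, ‖f a‖ ≤ C * ‖a‖) (x y : BSeq A) (h : qmk A x = qmk A y) :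
    qmk B (bmap f C hf x) = qmk B (bmap f C hf y) := by
  rw [qmk_eq] at h ⊢
  rw [tendsto_zero_iff_norm_tendsto_zero] at h ⊢
  refine squeeze_zero (fun n => norm_nonneg _) (fun n => ?_) (by simpa using h.const_mul C)
  simp only [bmap, AddMonoidHom.coe_mk, ZeroHom.coe_mk]
  rw [← map_sub]
  exact hf _

/-- induced map on sequence algebras -/
def qmap {A B : Type*} [NormedRing A] [NormedRing B] (f : A →+ B) (C : ℝ)
    (hf : ∀ a, ‖f a‖ ≤ C * ‖a‖) : SQ A →+ SQ B where
  toFun x := qmk B (bmap f C hf (qsec x))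
  map_zero' := by
    rw [bmap_congr f C hf _ 0 (by rw [qmk_qsec, map_zero]), map_zero, map_zero]
  map_add' x y := by
    rw [← map_add, ← map_add]
    apply bmap_congr
    rw [map_add]
    simp only [qmk_qsec]

lemma qmap_mk {A B : Type*} [NormedRing A] [NormedRing B] (f : A →+ B) (C : ℝ)
    (hf : ∀ a, ‖f a‖ ≤ C * ‖a‖) (x : BSeq A) : 
    qmap f C hf (qmk A x) = qmk B (bmap f C hf x) := by
  apply bmap_congr
  rw [qmk_qsec]

theorem abstract_mult {RA RP A P : Type*} [Ring RA] [Ring RP] [Ring A] [Ring P]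
    (CA : A →+* RA) (CP : P →+* RP) (ι : P →+* A) (E : A →+ P) (I : RP → RA) (F : RA →+ RP)
    (hIC : ∀ p, I (CP p) = CA (ι p))
    (hF1 : ∀ p x, F (I p * x) = p * F x) (hF2 : ∀ p x, F (x * I p) = F x * p)
    (e : RA) (hee : e * e = e) (hec : ∀ a, e * CA a = CA a * e)
    (J : P) (hJ1 : CP J * F e = 1) (hJ2 : F e * CP J = 1)
    (hcent : ∀ p, CP J * p = p * CP J)
    {m : ℕ} (w ws : Fin m → A) 
    (hqA : ∀ x : A, x = ∑ i, ι (E (x * w i)) * ws i)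
    (hqb : ∀ x : RA, x = ∑ i, I (F (x * CA (w i))) * CA (ws i))
    (hind : ∑ i, w i * ws i = ι J)
    (β : A → RP) (hβ : ∀ a, β a = CP J * F (e * CA a))
    (hpos : ∑ i, F ((CA (w i) * e - I (β (w i)) * e) * (e * CA (ws i) - e * I (β (ws i)))) = 0 → 
      ∀ i a, F (CA a * (e * CA (ws i) - e * I (β (ws i)))) = 0) :
    (∀ a b, β (a * b) = β a * β b) ∧ β 1 = 1 ∧ ∀ p, β (ι p) = CP p := by
  have hcW : ∀ p, F e * p = p * F e := by
    intro p
    calc F e * p = F e * (p * CP J) * F e := by rw [mul_assoc, mul_assoc, hJ1, mul_one]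
      _ = F e * (CP J * p) * F e := by rw [hcent]
      _ = F e * CP J * p * F e := by noncomm_ring
      _ = p * F e := by rw [hJ2, one_mul]
  have hFe : ∀ a, F (e * CA a) = F e * β a := by
    intro a; rw [hβ, ← mul_assoc, hJ2, one_mul]
  have hFe' : ∀ a, F (CA a * e) = F e * β a := by
    intro a; rw [← hec, hFe]
  have hβadd : ∀ a b, β (a + b) = β a + β b := by
    intro a b; simp only [hβ, map_add, mul_add]
  have hβsum : ∀ f : Fin m → A, β (∑ i, f i) = ∑ i, β (f i) := by
    intro f
    simp only [hβ, map_sum, Finset.mul_sum]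
  have hβι : ∀ p, β (ι p) = CP p := by
    intro p
    rw [hβ, ← hIC, hF2, ← mul_assoc, hJ1, one_mul]
  have hβl : ∀ p a, β (ι p * a) = CP p * β a := by
    intro p a
    rw [hβ, map_mul CA, ← mul_assoc e, hec, mul_assoc, ← hIC, hF1, ← mul_assoc, hcent, hβ, mul_assoc]
  have hβr : ∀ p a, β (a * ι p) = β a * CP p := by
    intro p a
    rw [hβ, map_mul CA, ← mul_assoc e, ← hIC, hF2, hβ, mul_assoc]
  have hee' : ∀ x, e * (e * x) = e * x := by intro x; rw [← mul_assoc, hee]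
  have key : ∀ y z, F ((CA y * e - I (β y) * e) * (e * CA z - e * I (β z)))
      = F e * (β (y * z) - β y * β z) := by
    intro y z
    have h1 : (CA y * e - I (β y) * e) * (e * CA z - e * I (β z))
      = e * CA (y * z) - CA y * e * I (β z) - I (β y) * (e * CA z) + I (β y) * (e * I (β z)) := by
      have h0 : e * CA (y * z) = CA y * (e * CA z) := by
        rw [map_mul, ← mul_assoc, hec, mul_assoc]
      rw [h0]
      simp only [mul_sub, sub_mul, mul_assoc, hee']
      abel
    rw [h1, map_add, map_sub, map_sub, hFe, hF2, hF1, hFe', hFe, hF1, hF2]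
    have h2 : β y * (F e * β z) = F e * (β y * β z) := by rw [← mul_assoc, ← hcW, mul_assoc]
    rw [h2]
    noncomm_ring
  have hs1 : ∑ i, β (w i) * β (ws i) = CP J := by
    have h1 : ∀ i, β (w i) * β (ws i) = 
        CP J * CP J * F (I (F (e * CA (w i))) * CA (ws i) * e) := by
      intro i
      rw [mul_assoc (I _), hF1, ← hec, hβ, hβ]
      have := hcent (F (e * CA (w i)))
      calc _ = CP J * (F (e * CA (w i)) * CP J) * F (e * CA (ws i)) := by noncomm_ring
        _ = _ := by rw [← this]; noncomm_ring
    simp only [h1]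
    rw [← Finset.mul_sum, ← map_sum, ← Finset.sum_mul, ← hqb, hee, mul_assoc, hJ1, mul_one]
  have hs0 : ∑ i, F ((CA (w i) * e - I (β (w i)) * e) * (e * CA (ws i) - e * I (β (ws i)))) = 0 := by
    simp only [key]
    rw [← Finset.mul_sum, Finset.sum_sub_distrib, hs1, ← hβsum, hind, hβι, sub_self, mul_zero]
  have hp := hpos hs0
  have hm : ∀ i a, β (a * ws i) = β a * β (ws i) := by
    intro i a
    have h1 := hp i a
    rw [mul_sub, map_sub, ← mul_assoc, ← mul_assoc, hF2, ← hec, mul_assoc, ← map_mul, hFe, hFe,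
      mul_assoc, ← mul_sub] at h1
    have h2 : CP J * (F e * (β (a * ws i) - β a * β (ws i))) = 0 := by rw [h1, mul_zero]
    rw [← mul_assoc, hJ1, one_mul] at h2
    exact sub_eq_zero.1 h2
  refine ⟨?_, ?_, hβι⟩
  · intro a z
    conv_lhs => rw [hqA z]
    conv_rhs => rw [hqA z]
    rw [Finset.mul_sum, hβsum, hβsum, Finset.mul_sum]
    refine Finset.sum_congr rfl fun i _ => ?_
    rw [← mul_assoc, hm, hβr, hβl, mul_assoc]
  · rw [hβ, map_one, mul_one, hJ1]

section CondExp
variable {P A : Type*} [CStarAlgebra P] [PartialOrder P] [StarOrderedRing P]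
  [CStarAlgebra A] [PartialOrder A] [StarOrderedRing A]

lemma ce_pos {ι : P →⋆ₐ[ℂ] A} {E : A →ₗ[ℂ] P} (hE : IsCondExpect ι E) (x : A) (hx : 0 ≤ x) :
    0 ≤ E x := by
  obtain ⟨y, rfl⟩ := CStarAlgebra.nonneg_iff_eq_star_mul_self.1 hx
  obtain ⟨z, hz⟩ := hE.pos y
  rw [hz]
  exact star_mul_self_nonneg z

lemma ce_star {ι : P →⋆ₐ[ℂ] A} {E : A →ₗ[ℂ] P} (hE : IsCondExpect ι E) (x : A) :
    E (star x) = star (E x) :=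
  map_star (PositiveLinearMap.mk₀ E (ce_pos hE)) x

lemma ce_bound {ι : P →⋆ₐ[ℂ] A} {E : A →ₗ[ℂ] P} (hE : IsCondExpect ι E) :
    ∃ C : ℝ, ∀ x, ‖E x‖ ≤ C * ‖x‖ := by
  obtain ⟨C, hC⟩ := PositiveLinearMap.exists_norm_apply_le (PositiveLinearMap.mk₀ E (ce_pos hE))
  exact ⟨C, hC⟩

lemma ce_left {ι : P →⋆ₐ[ℂ] A} {E : A →ₗ[ℂ] P} (hE : IsCondExpect ι E) (p : P) (x : A) :
    E (ι p * x) = p * E x := by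
  simpa using hE.bimodule p 1 x

lemma ce_right {ι : P →⋆ₐ[ℂ] A} {E : A →ₗ[ℂ] P} (hE : IsCondExpect ι E) (p : P) (x : A) :
    E (x * ι p) = E x * p := by
  simpa using hE.bimodule 1 p x

lemma ce_kadison {ι : P →⋆ₐ[ℂ] A} {E : A →ₗ[ℂ] P} (hE : IsCondExpect ι E) (y : A) :
    star (E y) * E y ≤ E (star y * y) := by
  have h := ce_pos hE _ (star_mul_self_nonneg (y - ι (E y)))
  have h2 : E (star (y - ι (E y)) * (y - ι (E y))) = E (star y * y) - star (E y) * E y := by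
    rw [star_sub, ← map_star, mul_sub, sub_mul, sub_mul]
    simp only [map_sub, ce_left hE, ce_right hE, hE.restricts, ce_star hE]
    abel
  rw [h2] at h
  exact sub_nonneg.1 h

lemma ce_schwarz {ι : P →⋆ₐ[ℂ] A} {E : A →ₗ[ℂ] P} (hE : IsCondExpect ι E) (b x : A) :
    ‖E (b * x)‖ ≤ ‖b‖ * Real.sqrt ‖E (star x * x)‖ := by
  have h1 := ce_kadison hE (b * x)
  have h2 : star (b * x) * (b * x) ≤ ‖star b * b‖ • (star x * x) := by
    have := CStarAlgebra.star_left_conjugate_le_norm_smul (a := x) (b := star b * b)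
      (IsSelfAdjoint.star_mul_self b)
    simpa [mul_assoc] using this
  have h3 : E (star (b * x) * (b * x)) ≤ ‖star b * b‖ • E (star x * x) := by
    have := ce_pos hE _ (sub_nonneg.2 h2)
    rw [map_sub, sub_nonneg, LinearMap.map_smul_of_tower] at this
    exact this
  have h4 := CStarAlgebra.norm_le_norm_of_nonneg_of_le (star_mul_self_nonneg _) (h1.trans h3)
  rw [CStarRing.norm_star_mul_self, norm_smul, CStarRing.norm_star_mul_self] at h4
  simp only [norm_mul, norm_norm] at h4
  apply abs_le_of_sq_le_sq' _ (by positivity) |>.2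
  rw [mul_pow, Real.sq_sqrt (norm_nonneg _)]
  nlinarith

lemma ce_basis {ι : P →⋆ₐ[ℂ] A} {E : A →ₗ[ℂ] P} (hE : IsCondExpect ι E)
    {m : ℕ} (u v : Fin m → A) (hqb : IsQuasiBasis ι E u v) :
    ∃ w : Fin m → A, (∀ x, x = ∑ i, ι (E (x * w i)) * star (w i)) ∧ 
      ∑ i, w i * star (w i) = ∑ i, u i * v i := by
  have hst : ∀ x, ∑ j, ι (E (x * star (v j))) * star (u j) = x := by
    intro x
    have := congrArg star (hqb (star x)).1
    rw [star_star, star_sum] at this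
    conv_rhs => rw [this]
    refine Finset.sum_congr rfl fun j _ => ?_
    rw [star_mul, ← map_star, ← ce_star hE, star_mul, star_star]
  obtain ⟨H, hH, hG⟩ := aux_factor (Matrix.of fun i j => E (v i * star (v j))) (by
      ext i j
      rw [Matrix.star_apply, Matrix.of_apply, Matrix.of_apply, ← ce_star hE, star_mul, star_star]) (by
      intro c
      have h := ce_pos hE _ (star_mul_self_nonneg (∑ k, star (v k) * ι (c k)))
      convert h using 1
      simp only [star_sum, Finset.sum_mul, Finset.mul_sum, map_sum]
      rw [Finset.sum_comm]
      refine Finset.sum_congr rfl fun i _ => Finset.sum_congr rfl fun k _ => ?_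
      rw [star_mul, star_star, ← map_star, ← mul_assoc, mul_assoc (ι _), ce_right hE, ce_left hE]
      rfl)
  have hGe : ∀ i j, ∑ k, H i k * H k j = E (v i * star (v j)) := by
    intro i j
    rw [← Matrix.mul_apply, ← hG, Matrix.of_apply]
  have hw : ∀ k, star (∑ i, u i * ι (H i k)) = ∑ j, ι (H k j) * star (u j) := by
    intro k
    rw [star_sum]
    refine Finset.sum_congr rfl fun j _ => ?_
    rw [star_mul, ← map_star, ← Matrix.star_apply, hH]
  refine ⟨fun k => ∑ i, u i * ι (H i k), ?_, ?_⟩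
  · intro x
    have h1 : ∀ k, ι (E (x * ∑ i, u i * ι (H i k))) * star (∑ i, u i * ι (H i k))
        = ∑ i, ∑ j, ι (E (x * u i)) * (ι (H i k * H k j)) * star (u j) := by
      intro k
      rw [hw, Finset.mul_sum Finset.univ (fun i => u i * ι (H i k)) x, map_sum, map_sum, Finset.sum_mul_sum]
      refine Finset.sum_congr rfl fun i _ => Finset.sum_congr rfl fun j _ => ?_
      rw [← mul_assoc x, ce_right hE, map_mul ι, map_mul ι]
      noncomm_ring
    simp only [h1]
    rw [Finset.sum_comm]
    simp only [fun y => Finset.sum_comm (s := (Finset.univ : Finset (Fin m))) (t := (Finset.univ : Finset (Fin m))) (f := fun k j => ι (E (x * u y)) * (ι (H y k * H k j)) * star (u j))]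
    simp only [← Finset.sum_mul, ← Finset.mul_sum, ← map_sum, hGe]
    rw [Finset.sum_comm]
    simp only [← map_mul ι, ← ce_left hE, ← mul_assoc, ← Finset.sum_mul, ← map_sum]
    rw [← (hqb x).2, hst]
  · simp only [hw]
    have h1 : ∀ k, (∑ i, u i * ι (H i k)) * (∑ j, ι (H k j) * star (u j)) 
        = ∑ i, ∑ j, u i * (ι (H i k * H k j)) * star (u j) := by
      intro k
      rw [Finset.sum_mul_sum]
      refine Finset.sum_congr rfl fun i _ => Finset.sum_congr rfl fun j _ => ?_
      rw [map_mul]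
      noncomm_ring
    simp only [h1]
    rw [Finset.sum_comm]
    refine Finset.sum_congr rfl fun i _ => ?_
    rw [Finset.sum_comm]
    simp only [← Finset.sum_mul, ← Finset.mul_sum, ← map_sum, hGe]
    simp only [mul_assoc]
    rw [← Finset.mul_sum, hst]

end CondExp

/-- coordinatewise adjoint -/
def bstar {A : Type*} [CStarAlgebra A] (x : BSeq A) : BSeq A :=
  ⟨fun n => star (x.1 n), by
    obtain ⟨M, hM⟩ := x.2
    exact ⟨M, fun n => by simpa using hM n⟩⟩

lemma bstar_congr {A : Type*} [CStarAlgebra A] (x y : BSeq A) (h : qmk A x = qmk A y) :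
    qmk A (bstar x) = qmk A (bstar y) := by
  rw [qmk_eq] at h ⊢
  rw [tendsto_zero_iff_norm_tendsto_zero] at h ⊢
  refine h.congr fun n => ?_
  simp only [bstar]
  rw [← star_sub, norm_star]

lemma bstar_mul {A : Type*} [CStarAlgebra A] (x y : BSeq A) : 
    bstar (x * y) = bstar y * bstar x := by
  ext n
  exact star_mul _ _

lemma bstar_sub {A : Type*} [CStarAlgebra A] (x y : BSeq A) : 
    bstar (x - y) = bstar x - bstar y := by
  ext n
  exact star_sub _ _

lemma bstar_const {A : Type*} [CStarAlgebra A] (a : A) : 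
    bstar (qconst A a) = qconst A (star a) := rfl

lemma bstar_bmap {A B : Type*} [CStarAlgebra A] [CStarAlgebra B] (f : A →+ B) (C : ℝ)
    (hf : ∀ a, ‖f a‖ ≤ C * ‖a‖) (hs : ∀ a, f (star a) = star (f a)) (x : BSeq A) : 
    bstar (bmap f C hf x) = bmap f C hf (bstar x) := by
  ext n
  exact (hs _).symm

section Idx
variable {P A : Type*} [CStarAlgebra P] [PartialOrder P] [StarOrderedRing P]
  [CStarAlgebra A] [PartialOrder A] [StarOrderedRing A]

lemma idx_lemma {ι : P →⋆ₐ[ℂ] A} {E : A →ₗ[ℂ] P} (hE : IsCondExpect ι E)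
    {m : ℕ} (u v : Fin m → A) (hqb : IsQuasiBasis ι E u v) (e : ℕ → A) (w : A) 
    (h1 : w * (∑ i, u i * v i) = 1) (h2 : (∑ i, u i * v i) * w = 1)
    (hw : Tendsto (fun k => ‖ι (E (e k)) - w‖) atTop (𝓝 0)) :
    ∃ J K : P, ι J = ∑ i, u i * v i ∧ J * K = 1 ∧ K * J = 1 ∧ (∀ p, J * p = p * J) ∧ star J = J ∧
      Tendsto (fun k => E (e k)) atTop (𝓝 K) := by
  have hinj : Function.Injective ι := fun x y h => by rw [← hE.restricts x, h, hE.restricts]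
  obtain ⟨w', -, hw'2⟩ := ce_basis hE u v hqb
  have hcent : ∀ a, a * (∑ i, u i * v i) = (∑ i, u i * v i) * a := by
    intro a
    have e1 : ∀ i, a * (u i * v i) = ∑ k, u k * ι (E (v k * (a * u i))) * v i := by
      intro i
      rw [← Finset.sum_mul, ← (hqb (a * u i)).1, mul_assoc]
    have e2 : ∀ k, (u k * v k) * a = ∑ i, u k * ι (E (v k * (a * u i))) * v i := by
      intro k
      simp only [mul_assoc (u k)]
      rw [← Finset.mul_sum]
      simp only [← mul_assoc (v k)]
      rw [← (hqb (v k * a)).2]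
    rw [Finset.mul_sum, Finset.sum_mul]
    simp only [e1, e2]
    rw [Finset.sum_comm]
  obtain ⟨C, hC⟩ := ce_bound hE
  have hK : Tendsto (fun k => E (e k)) atTop (𝓝 (E w)) := by
    rw [tendsto_iff_norm_sub_tendsto_zero]
    refine squeeze_zero (fun n => norm_nonneg _) (fun n => ?_) (by simpa using hw.const_mul C)
    have := hC (ι (E (e n)) - w)
    rwa [map_sub, hE.restricts] at this
  have hιK : ι (E w) = w := by
    have c1 : Tendsto (fun k => ι (E (e k))) atTop (𝓝 (ι (E w))) := by
      rw [tendsto_iff_norm_sub_tendsto_zero] at hK ⊢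
      refine squeeze_zero (fun n => norm_nonneg _) (fun n => ?_) hK
      rw [← map_sub]
      exact NonUnitalStarAlgHom.norm_apply_le ι _
    exact tendsto_nhds_unique c1 (tendsto_iff_norm_sub_tendsto_zero.2 hw)
  have hKJ : E w * E (∑ i, u i * v i) = 1 := by
    rw [← ce_left hE, hιK, h1, ← map_one ι, hE.restricts]
  have hJK : E (∑ i, u i * v i) * E w = 1 := by
    rw [← ce_right hE, hιK, h2, ← map_one ι, hE.restricts]
  have hιJ : ι (E (∑ i, u i * v i)) = ∑ i, u i * v i := by
    calc ι (E (∑ i, u i * v i)) = (∑ i, u i * v i) * ι (E w) * ι (E (∑ i, u i * v i)) := by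
          rw [hιK, h2, one_mul]
      _ = _ := by rw [mul_assoc, ← map_mul ι, hKJ, map_one, mul_one]
  refine ⟨E (∑ i, u i * v i), E w, hιJ, hJK, hKJ, ?_, ?_, hK⟩
  · intro p
    apply hinj
    rw [map_mul, map_mul, hιJ, hcent]
  · rw [← ce_star hE]
    congr 1
    rw [← hw'2, star_sum]
    refine Finset.sum_congr rfl fun i _ => ?_
    rw [star_mul, star_star]

theorem main_beta {ι : P →⋆ₐ[ℂ] A} {E : A →ₗ[ℂ] P} (hE : IsCondExpect ι E)
    {m : ℕ} (u v : Fin m → A) (hqb : IsQuasiBasis ι E u v)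
    (hRok : CondExpectHasRokhlin ι E (∑ i, u i * v i)) :
    ∃ b : A → BSeq P, (∀ a c, qmk P (b (a * c)) = qmk P (b a) * qmk P (b c)) ∧
      (∀ a c, b (a + c) = b a + b c) ∧ (∀ a, qmk P (b (star a)) = qmk P (bstar (b a))) ∧
      ∀ p, qmk P (b (ι p)) = qmk P (qconst P p) := by
  obtain ⟨e, ⟨M, hM⟩, hee, hes, hec, ⟨w0, hw1, hw2, hw3⟩, -⟩ := hRok
  obtain ⟨J, K, hιJ, hJK, hKJ, hJc, hJs, hlim⟩ := idx_lemma hE u v hqb e w0 hw1 hw2 hw3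
  obtain ⟨w, hwb, hwi⟩ := ce_basis hE u v hqb
  obtain ⟨C, hC⟩ := ce_bound hE
  have hιn : ∀ p : P, ‖((ι : P →+* A) : P →+ A) p‖ ≤ 1 * ‖p‖ := fun p => by
    rw [one_mul]; exact NonUnitalStarAlgHom.norm_apply_le ι p
  let eb : BSeq A := ⟨e, M, hM⟩
  let Fb := bmap E.toAddMonoidHom C hC
  let Ib := bmap ((ι : P →+* A) : P →+ A) 1 hιn
  let F := qmap E.toAddMonoidHom C hC
  let I := qmap ((ι : P →+* A) : P →+ A) 1 hιn
  let CA := (qmk A).comp (qconst A)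
  let CP := (qmk P).comp (qconst P)
  have hFm : ∀ x, F (qmk A x) = qmk P (Fb x) := qmap_mk _ _ _
  have hIm : ∀ x, I (qmk P x) = qmk A (Ib x) := qmap_mk _ _ _
  have hCA : ∀ x, CA x = qmk A (qconst A x) := fun _ => rfl
  have hCP : ∀ x, CP x = qmk P (qconst P x) := fun _ => rfl
  have hFs : ∀ x, bstar (Fb x) = Fb (bstar x) :=
    bstar_bmap E.toAddMonoidHom C hC (fun a => ce_star hE a)
  have hIs : ∀ x, bstar (Ib x) = Ib (bstar x) :=
    bstar_bmap ((ι : P →+* A) : P →+ A) 1 hιn (fun a => map_star ι a)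
  have hF1 : ∀ p x, F (I p * x) = p * F x := by
    intro p x
    obtain ⟨p, rfl⟩ := qmk_surj p
    obtain ⟨x, rfl⟩ := qmk_surj x
    rw [hIm, hFm, ← map_mul, hFm, ← map_mul]
    congr 1
    ext n
    exact ce_left hE _ _
  have hF2 : ∀ p x, F (x * I p) = F x * p := by
    intro p x
    obtain ⟨p, rfl⟩ := qmk_surj p
    obtain ⟨x, rfl⟩ := qmk_surj x
    rw [hIm, hFm, ← map_mul, hFm, ← map_mul]
    congr 1
    ext n
    exact ce_right hE _ _
  have hIC : ∀ p, I (CP p) = CA (ι p) := by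
    intro p
    rw [hCP, hIm, hCA]
    rfl
  have hee' : qmk A eb * qmk A eb = qmk A eb := by
    rw [← map_mul, qmk_eq, tendsto_zero_iff_norm_tendsto_zero]
    exact hee
  have hes' : qmk A (bstar eb) = qmk A eb := by
    rw [qmk_eq, tendsto_zero_iff_norm_tendsto_zero]
    exact hes
  have hec' : ∀ a, qmk A eb * CA a = CA a * qmk A eb := by
    intro a
    rw [hCA, ← map_mul, ← map_mul, qmk_eq, tendsto_zero_iff_norm_tendsto_zero]
    exact hec a
  have hFe : F (qmk A eb) = CP K := by
    rw [hFm, hCP, qmk_eq]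
    have := hlim.sub_const K
    rw [sub_self] at this
    exact this
  have hcent : ∀ p, CP J * p = p * CP J := by
    intro p
    obtain ⟨p, rfl⟩ := qmk_surj p
    rw [hCP, ← map_mul, ← map_mul]
    congr 1
    ext n
    exact hJc _
  let b : A → BSeq P := fun a => qconst P J * Fb (eb * qconst A a)
  have hb : ∀ a, qmk P (b a) = CP J * F (qmk A eb * CA a) := by
    intro a
    rw [hCP, hCA, ← map_mul, hFm, ← map_mul]
  have hbs : ∀ a, qmk P (bstar (b a)) = qmk P (b (star a)) := by
    intro a
    have : bstar (b a) = Fb (qconst A (star a) * bstar eb) * qconst P J := by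
      rw [bstar_mul, bstar_const, hJs, hFs, bstar_mul, bstar_const]
    rw [this, map_mul, ← hFm, map_mul, hes', hb, hcent, hec']
    rfl
  have hmain := abstract_mult CA CP (ι : P →+* A) E.toAddMonoidHom I F hIC hF1 hF2 (qmk A eb) hee' 
    hec' J (by rw [hFe, ← map_mul, hJK, map_one]) (by rw [hFe, ← map_mul, hKJ, map_one]) hcent
    w (fun i => star (w i)) hwb (by
      intro x
      obtain ⟨x, rfl⟩ := qmk_surj x
      have : ∀ i, I (F (qmk A x * CA (w i))) * CA (star (w i)) = 
          qmk A (Ib (Fb (x * qconst A (w i))) * qconst A (star (w i))) := by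
        intro i
        rw [hCA, ← map_mul, hFm, hIm, hCA, ← map_mul]
      simp only [this]
      rw [← map_sum]
      congr 1
      ext n
      rw [AddSubmonoidClass.coe_finsetSum, Finset.sum_apply]
      exact hwb (x.1 n)) (by rw [hwi]; exact hιJ.symm) (fun a => qmk P (b a)) hb (by
      intro h0 i a
      let tb : Fin m → BSeq A := fun i => eb * qconst A (star (w i)) - eb * Ib (b (star (w i)))
      have ht : ∀ i, qmk A eb * CA (star (w i)) - qmk A eb * I (qmk P (b (star (w i)))) = 
          qmk A (tb i) := by
        intro i
        rw [map_sub, map_mul (qmk A) eb, map_mul (qmk A) eb, hIm, hCA]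
      have hs : ∀ i, CA (w i) * qmk A eb - I (qmk P (b (w i))) * qmk A eb = 
          qmk A (bstar (tb i)) := by
        intro i
        have : bstar (tb i) = qconst A (w i) * bstar eb - Ib (bstar (b (star (w i)))) * bstar eb := by
          rw [bstar_sub, bstar_mul, bstar_mul, bstar_const, star_star, 
            hIs]
        rw [this, map_sub, map_mul (qmk A) _ (bstar eb), map_mul (qmk A) _ (bstar eb), hes', ← hIm, hbs, star_star, hCA]
      simp only [ht, hs, ← map_mul, hFm] at h0 ⊢
      rw [← map_sum, ← map_zero (qmk P), qmk_eq] at h0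
      rw [← map_zero (qmk P), hCA, ← map_mul, hFm, qmk_eq]
      have h0' : Tendsto (fun n => ∑ i, E (star ((tb i).1 n) * (tb i).1 n)) atTop (𝓝 0) := by
        refine h0.congr fun n => ?_
        rw [AddSubmonoidClass.coe_finsetSum, Finset.sum_apply]
        exact sub_zero _
      have h1 : Tendsto (fun n => ‖E (star ((tb i).1 n) * (tb i).1 n)‖) atTop (𝓝 0) := by
        rw [tendsto_zero_iff_norm_tendsto_zero] at h0'
        refine squeeze_zero (fun n => norm_nonneg _) (fun n => ?_) h0'
        apply CStarAlgebra.norm_le_norm_of_nonneg_of_le (ce_pos hE _ (star_mul_self_nonneg _))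
        exact Finset.single_le_sum (f := fun i => E (star ((tb i).1 n) * (tb i).1 n))
          (fun k _ => ce_pos hE _ (star_mul_self_nonneg _)) (Finset.mem_univ i)
      have h2 := (h1.sqrt).const_mul ‖a‖
      rw [Real.sqrt_zero, mul_zero] at h2
      rw [tendsto_zero_iff_norm_tendsto_zero]
      refine squeeze_zero (fun n => norm_nonneg _) (fun n => ?_) h2
      refine le_trans (le_of_eq ?_) (ce_schwarz hE a ((tb i).1 n))
      congr 1
      exact sub_zero _)
  refine ⟨b, hmain.1, ?_, fun a => (hbs a).symm, hmain.2.2⟩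
  intro a c
  simp only [b, map_add, mul_add]
end Idx

lemma final_polar {P : Type*} [CStarAlgebra P] [PartialOrder P] [StarOrderedRing P] {k l : ℕ}
    (p : Matrix (Fin k) (Fin k) P) (q : Matrix (Fin l) (Fin l) P)
    (hp : p * p = p) (hps : star p = p) (hq : q * q = q) (hqs : star q = q)
    (V : ℕ → Matrix (Fin l) (Fin k) P)
    (hV : Tendsto (fun n => (V n).conjTranspose * q * V n) atTop (𝓝 p)) :
    ∃ v : Matrix (Fin l) (Fin k) P,
      v.conjTranspose * v = p ∧ IsPosElem (q - v * v.conjTranspose) := by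
  have hps' : p.conjTranspose = p := hps
  have hqs' : q.conjTranspose = q := hqs
  have hcc : ∀ n, (q * V n * p).conjTranspose * (q * V n * p) = 
      p * ((V n).conjTranspose * q * V n) * p := by
    intro n
    simp only [Matrix.conjTranspose_mul, hps', hqs', Matrix.mul_assoc]
    rw [← Matrix.mul_assoc q q, hq]
  have hlim : Tendsto (fun n => (q * V n * p).conjTranspose * (q * V n * p) + (1 - p)) atTop (𝓝 1) := by
    have hc : Continuous (fun M : Matrix (Fin k) (Fin k) P => p * M * p + (1 - p)) := 
      ((continuous_const.matrix_mul continuous_id).matrix_mul continuous_const).add continuous_const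
    have := (hc.tendsto p).comp hV
    simp only [hp, add_sub_cancel] at this
    refine this.congr fun n => ?_
    rw [hcc]
    rfl
  obtain ⟨n, d, hds, hd1, hdc⟩ := aux_invsqrt_mat
    (fun n => (q * V n * p).conjTranspose * (q * V n * p) + (1 - p)) (by
      intro n
      rw [star_add, star_sub, star_one, hps, Matrix.star_eq_conjTranspose,
        Matrix.conjTranspose_mul, Matrix.conjTranspose_conjTranspose]) (by
      intro i j
      exact tendsto_pi_nhds.1 (tendsto_pi_nhds.1 hlim i) j)
  set W := q * V n * p with hW
  have hWp : W * p = W := by rw [hW, Matrix.mul_assoc, hp]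
  have hpW : p * W.conjTranspose = W.conjTranspose := by
    conv_rhs => rw [← hWp, Matrix.conjTranspose_mul, hps']
  have hqW : q * W = W := by rw [hW, ← Matrix.mul_assoc, ← Matrix.mul_assoc, hq]
  have hdp : p * d = d * p := by
    apply hdc
    rw [mul_add, add_mul, ← Matrix.mul_assoc, hpW, Matrix.mul_assoc _ W p, hWp]
    noncomm_ring
  have hds' : d.conjTranspose = d := hds
  have h1 : (W * d).conjTranspose * (W * d) = p := by
    rw [Matrix.conjTranspose_mul, hds', Matrix.mul_assoc, ← Matrix.mul_assoc _ W d,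
      ← Matrix.mul_assoc]
    have hx : d * (W.conjTranspose * W) * d = p * (d * (W.conjTranspose * W + (1 - p)) * d) := by
      have e1 : p * (d * (W.conjTranspose * W)) = d * (W.conjTranspose * W) := by
        rw [← Matrix.mul_assoc, hdp, Matrix.mul_assoc, ← Matrix.mul_assoc p, hpW]
      have e2 : p * (d * (1 - p)) = 0 := by
        rw [← Matrix.mul_assoc, hdp, Matrix.mul_assoc, mul_sub, hp, mul_one, sub_self, mul_zero]
      rw [← Matrix.mul_assoc p, mul_add, mul_add, e1, e2, add_zero]
    rw [hx, hd1, mul_one]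
  refine ⟨W * d, h1, ?_⟩
  have h2 : W * d * p = W * d := by rw [Matrix.mul_assoc, ← hdp, ← Matrix.mul_assoc, hWp]
  have hqs2 : q * (W * d * (W * d).conjTranspose) = W * d * (W * d).conjTranspose := by
    rw [← Matrix.mul_assoc, ← Matrix.mul_assoc, hqW]
  have hss : star (W * d * (W * d).conjTranspose) = W * d * (W * d).conjTranspose := by
    rw [Matrix.star_eq_conjTranspose, Matrix.conjTranspose_mul, Matrix.conjTranspose_conjTranspose]
  have hs2 : (W * d * (W * d).conjTranspose) * (W * d * (W * d).conjTranspose) 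
      = W * d * (W * d).conjTranspose := by
    rw [Matrix.mul_assoc (W * d), ← Matrix.mul_assoc _ (W * d), h1, ← Matrix.mul_assoc, h2]
  have hsq : (W * d * (W * d).conjTranspose) * q = W * d * (W * d).conjTranspose := by
    have := congrArg star hqs2
    rwa [star_mul, hss, hqs] at this
  refine ⟨q - W * d * (W * d).conjTranspose, ?_⟩
  rw [star_sub, hqs, hss, mul_sub, sub_mul, sub_mul, hq, hqs2, hsq, hs2]
  abel

lemma final_range {A : Type*} [CStarAlgebra A] [PartialOrder A] [StarOrderedRing A] {k l : ℕ}
    (q : Matrix (Fin l) (Fin l) A) (hq : q * q = q) (hqs : star q = q) 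
    (v : Matrix (Fin l) (Fin k) A) (h : IsPosElem (q - v * v.conjTranspose)) : q * v = v := by
  obtain ⟨y, hy⟩ := h
  have hqs' : (1 - q).conjTranspose = 1 - q := by
    rw [Matrix.conjTranspose_sub, Matrix.conjTranspose_one, ← Matrix.star_eq_conjTranspose, hqs]
  have h0 : v.conjTranspose * (1 - q) = 0 := by
    apply aux_colzero
    intro j
    have : (v.conjTranspose * (1 - q)).conjTranspose * (v.conjTranspose * (1 - q)) = 
        - ((y * (1 - q)).conjTranspose * (y * (1 - q))) := by
      have e1 : (1 - q) * (q - v * v.conjTranspose) * (1 - q) = 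
          - ((1 - q) * (v * v.conjTranspose) * (1 - q)) := by
        have : (1 - q) * q = 0 := by rw [sub_mul, hq, one_mul, sub_self]
        rw [mul_sub (1 - q) q, this, zero_sub, neg_mul]
      rw [hy] at e1
      rw [Matrix.conjTranspose_mul, Matrix.conjTranspose_mul, hqs', Matrix.conjTranspose_conjTranspose]
      rw [Matrix.star_eq_conjTranspose] at e1
      simp only [Matrix.mul_assoc] at e1 ⊢
      rw [e1, neg_neg]
    rw [this, Matrix.neg_apply, neg_nonpos, Matrix.mul_apply]
    exact Finset.sum_nonneg fun i _ => star_mul_self_nonneg _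
  have h1 := congrArg Matrix.conjTranspose h0
  rw [Matrix.conjTranspose_mul, hqs', Matrix.conjTranspose_conjTranspose, 
    Matrix.conjTranspose_zero, Matrix.sub_mul, Matrix.one_mul, sub_eq_zero] at h1
  exact h1.symm

theorem final_main {P A : Type*} [CStarAlgebra P] [PartialOrder P] [StarOrderedRing P]
    [CStarAlgebra A] [PartialOrder A] [StarOrderedRing A]
    (hA : ProjOrderDeterminedByTraces A)
    (ι : P →⋆ₐ[ℂ] A)
    (E : A →ₗ[ℂ] P) (hE : IsCondExpect ι E)
    (m : ℕ) (u v : Fin m → A) (hqb : IsQuasiBasis ι E u v)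
    (hRok : CondExpectHasRokhlin ι E (∑ i, u i * v i)) :
    ProjOrderDeterminedByTraces P := by
  intro k l p q hp hps hq hqs hτ
  obtain ⟨b, hb1, hb2, hb3, hb4⟩ := main_beta hE u v hqb hRok
  have hmapmul : ∀ {n : ℕ} (x y : Matrix (Fin n) (Fin n) P), (x * y).map ι = x.map ι * y.map ι := 
    fun x y => Matrix.map_mul (f := (ι : P →+* A))
  have hmapstar : ∀ {n : ℕ} (x : Matrix (Fin n) (Fin n) P), star (x.map ι) = (star x).map ι := by
    intro n x
    ext i j
    rw [Matrix.star_apply, Matrix.map_apply, Matrix.map_apply, Matrix.star_apply]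
    exact (map_star ι _).symm
  obtain ⟨z, hz1, hz2⟩ := hA k l (p.map ι) (q.map ι) (by rw [← hmapmul, hp]) (by rw [hmapstar, hps])
    (by rw [← hmapmul, hq]) (by rw [hmapstar, hqs]) (by
      intro τ ⟨t1, t2, t3⟩
      have := hτ (τ ∘ₗ ι.toAlgHom.toLinearMap) ⟨by simpa using t1, fun x => by
          have := t2 (ι x)
          rw [← map_star ι x, ← map_mul ι] at this
          exact this, 
        fun x y => by simpa using t3 (ι x) (ι y)⟩
      exact this)
  have hqz := final_range (q.map ι) (by rw [← hmapmul, hq]) (by rw [hmapstar, hqs]) z hz2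
  have hzz : z.conjTranspose * q.map ι * z = p.map ι := by
    rw [Matrix.mul_assoc, hqz, hz1]
  apply final_polar p q hp hps hq hqs (fun n => Matrix.of fun i j => (b (z i j)).1 n)
  refine tendsto_pi_nhds.2 fun i => tendsto_pi_nhds.2 fun j => ?_
  let φ : A →+ SQ P := AddMonoidHom.mk' (fun a => qmk P (b a)) (fun a c => by rw [hb2, map_add])
  have hφ : ∀ a, φ a = qmk P (b a) := fun _ => rfl
  let X : BSeq P := ∑ s, (∑ r, bstar (b (z r i)) * qconst P (q r s)) * b (z s j)
  have hX : qmk P X = qmk P (qconst P (p i j)) := by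
    have e1 : φ ((z.conjTranspose * q.map ι * z) i j) = qmk P (qconst P (p i j)) := by
      rw [hzz, Matrix.map_apply, hφ, hb4]
    rw [← e1]
    simp only [Matrix.mul_apply, Matrix.map_apply, Matrix.conjTranspose_apply, X, map_sum]
    refine Finset.sum_congr rfl fun s _ => ?_
    rw [hφ, hb1, map_mul, ← hφ (∑ r, _)]
    congr 1
    rw [map_sum, map_sum]
    refine Finset.sum_congr rfl fun r _ => ?_
    rw [hφ, hb1, map_mul, hb3, hb4]
  rw [qmk_eq] at hX
  have h2 := hX.add_const (p i j)
  rw [zero_add] at h2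
  refine h2.congr fun n => ?_
  have hXn : X.1 n = ∑ s, (∑ r, star ((b (z r i)).1 n) * q r s) * (b (z s j)).1 n := by
    simp only [X]
    rw [AddSubmonoidClass.coe_finsetSum, Finset.sum_apply]
    refine Finset.sum_congr rfl fun s _ => ?_
    rw [Subring.coe_mul, Pi.mul_apply, AddSubmonoidClass.coe_finsetSum, Finset.sum_apply]
    rfl
  rw [hXn]
  simp only [Matrix.mul_apply, Matrix.conjTranspose_apply, Matrix.of_apply]
  exact sub_add_cancel _ _

theorem stmt11 (P A : Type) [CStarAlgebra P] [CStarAlgebra A]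
    (hA : ProjOrderDeterminedByTraces A)
    (ι : P →⋆ₐ[ℂ] A) (hι : Function.Injective ι)
    (E : A →ₗ[ℂ] P) (hE : IsCondExpect ι E)
    (m : ℕ) (u v : Fin m → A) (hqb : IsQuasiBasis ι E u v)
    (hRok : CondExpectHasRokhlin ι E (∑ i, u i * v i)) :
    ProjOrderDeterminedByTraces P := by
  letI := CStarAlgebra.spectralOrder P
  haveI := CStarAlgebra.spectralOrderedRing P
  letI := CStarAlgebra.spectralOrder A
  haveI := CStarAlgebra.spectralOrderedRing A
  exact final_main hA ι E hE m u v hqb hRok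

end
end

section
/- Let A be a unital exact C*-algebra with strict comparison, let P ⊆ A be an inclusion of unital C*-algebras, and let E : A → P be a conditional expectation of index finite type with the Rokhlin property. Then P has strict comparison. -/
noncomputable section
set_option linter.unusedSectionVars false

open scoped ComplexOrder Matrix.Norms.L2Operator
open Filter Topology

/-! ### Inclusions of unital C*-algebras, conditional expectations, Watatani index -/

variable {P A : Type*}

section Aux13

lemma aux_nnrpow_nat {B : Type*} [CStarAlgebra B] [PartialOrder B] [StarOrderedRing B]
    (b : B) (hb : 0 ≤ b) (j : ℕ) : b ^ ((j + 1 : ℕ) : NNReal) = b ^ (j + 1) := by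
  induction j with
  | zero => simp [CFC.nnrpow_one b hb]
  | succ k ih =>
    rw [Nat.cast_add, CFC.nnrpow_add (by positivity) (by norm_num), ih, Nat.cast_one,
      CFC.nnrpow_one b hb, ← pow_succ]

lemma aux_root {B : Type*} [CStarAlgebra B] (a : B) (ha : IsPosElem a) (j : ℕ) :
    ∃ b : B, IsPosElem b ∧ b ^ (j + 1) = a ∧ ∀ c : B, IsPosElem c → c ^ (j + 1) = a → c = b := by
  let _ := CStarAlgebra.spectralOrder B
  have _ := CStarAlgebra.spectralOrderedRing B
  have key : ∀ x : B, IsPosElem x → 0 ≤ x := by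
    rintro x ⟨y, rfl⟩
    exact star_mul_self_nonneg y
  have h0 : ((j + 1 : ℕ) : NNReal) ≠ 0 := by positivity
  refine ⟨a ^ (((j + 1 : ℕ) : NNReal)⁻¹), ?_, ?_, ?_⟩
  · exact CStarAlgebra.nonneg_iff_eq_star_mul_self.mp CFC.nnrpow_nonneg
  · rw [← aux_nnrpow_nat _ CFC.nnrpow_nonneg, CFC.nnrpow_inv_nnrpow a h0 (key a ha)]
  · intro c hc hca
    rw [← hca, ← aux_nnrpow_nat _ (key c hc), CFC.nnrpow_nnrpow_inv c h0 (key c hc)]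

lemma aux_mat_root {R : Type*} [CStarAlgebra R] {n : ℕ} (a : Matrix (Fin n) (Fin n) R)
    (ha : IsPosElem a) (j : ℕ) :
    ∃ b : Matrix (Fin n) (Fin n) R, IsPosElem b ∧ b ^ (j + 1) = a ∧
      ∀ c : Matrix (Fin n) (Fin n) R, IsPosElem c → c ^ (j + 1) = a → c = b := by
  let _ := CStarAlgebra.spectralOrder R
  have _ := CStarAlgebra.spectralOrderedRing R
  exact aux_root (B := CStarMatrix (Fin n) (Fin n) R) a ha j

lemma aux_matNthRoot {R : Type*} [CStarAlgebra R] {n : ℕ} (a : Matrix (Fin n) (Fin n) R)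
    (ha : IsPosElem a) (j : ℕ) (b : Matrix (Fin n) (Fin n) R) (hb : IsPosElem b)
    (hba : b ^ (j + 1) = a) : matNthRoot a (j + 1) = b := by
  have hex : ∃ b : Matrix (Fin n) (Fin n) R, IsPosElem b ∧ b ^ (j + 1) = a := ⟨b, hb, hba⟩
  obtain ⟨d, hd, hda, hu⟩ := aux_mat_root a ha j
  rw [matNthRoot, dif_pos hex, hu b hb hba]
  exact hu _ hex.choose_spec.1 hex.choose_spec.2

lemma aux_map_pos {P A : Type*} [CStarAlgebra P] [CStarAlgebra A] (ι : P →⋆ₐ[ℂ] A) {n : ℕ}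
    (a : Matrix (Fin n) (Fin n) P) (ha : IsPosElem a) : IsPosElem (a.map ι) := by
  obtain ⟨y, rfl⟩ := ha
  refine ⟨y.map ι, ?_⟩
  ext i j
  simp [Matrix.mul_apply, Matrix.star_apply, map_sum, map_mul, map_star]

lemma aux_dimFun {P A : Type*} [CStarAlgebra P] [CStarAlgebra A] (ι : P →⋆ₐ[ℂ] A) {n : ℕ}
    (a : Matrix (Fin n) (Fin n) P) (ha : IsPosElem a) (σ : A →ₗ[ℂ] ℂ) :
    dimFun σ (a.map ι) = dimFun (σ ∘ₗ ι.toAlgHom.toLinearMap) a := by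
  unfold dimFun
  congr 1
  ext j
  obtain ⟨b, hb, hba, -⟩ := aux_mat_root a ha j
  rw [aux_matNthRoot a ha j b hb hba,
    aux_matNthRoot (a.map ι) (aux_map_pos ι a ha) j (b.map ι) (aux_map_pos ι b hb) ?_]
  · simp [traceExt]
  · rw [← hba]
    exact (map_pow (RingHom.mapMatrix (ι : P →+* A)) b (j+1)).symm

lemma aux_tracial {P A : Type*} [CStarAlgebra P] [CStarAlgebra A] (ι : P →⋆ₐ[ℂ] A)
    (σ : A →ₗ[ℂ] ℂ) (hσ : IsTracialState σ) :
    IsTracialState (σ ∘ₗ ι.toAlgHom.toLinearMap) := by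
  obtain ⟨h1, h2, h3⟩ := hσ
  refine ⟨by simpa using h1, fun x => ?_, fun a b => ?_⟩
  · simpa [map_star] using h2 (ι x)
  · simpa using h3 (ι a) (ι b)

lemma aux_sum_zero {B : Type*} [CStarAlgebra B] [PartialOrder B] [StarOrderedRing B]
    {n : ℕ} (s : Fin n → B) (h : ∑ l, star (s l) * s l ≤ 0) (l : Fin n) : s l = 0 := by
  have h1 : star (s l) * s l ≤ ∑ l, star (s l) * s l :=
    Finset.single_le_sum (f := fun l => star (s l) * s l)
      (fun i _ => star_mul_self_nonneg (s i)) (Finset.mem_univ l)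
  exact CStarRing.star_mul_self_eq_zero_iff _ |>.mp
    (le_antisymm (h1.trans h) (star_mul_self_nonneg _))

lemma aux_neg {B : Type*} [CStarAlgebra B] (G : B) (hsa : IsSelfAdjoint G) :
    ∃ N S : B, star N = N ∧ N * G * N = - (star S * S) ∧ (S = 0 → IsPosElem G) := by
  let _ := CStarAlgebra.spectralOrder B
  have _ := CStarAlgebra.spectralOrderedRing B
  set N := G⁻ with hN
  have hN0 : 0 ≤ N := CFC.negPart_nonneg G
  have hNs : star N = N := (IsSelfAdjoint.of_nonneg hN0).star_eq
  have hdec : G⁺ - N = G := CFC.posPart_sub_negPart G hsa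
  have hmul : N * G = - (N * N) := by
    conv_lhs => rw [← hdec]
    rw [mul_sub, CFC.negPart_mul_posPart, zero_sub]
  have hcub : N * G * N = - (star (CFC.sqrt N * N) * (CFC.sqrt N * N)) := by
    rw [hmul, star_mul, hNs, (IsSelfAdjoint.of_nonneg (CFC.sqrt_nonneg N)).star_eq, neg_mul]
    congr 1
    calc N * N * N = N * (CFC.sqrt N * CFC.sqrt N) * N := by rw [CFC.sqrt_mul_sqrt_self N hN0]
      _ = _ := by simp only [mul_assoc]
  refine ⟨N, CFC.sqrt N * N, hNs, hcub, fun hSz => ?_⟩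
  have h4 : star (N * N) * (N * N) = 0 := by
    have : N * G * N = 0 := by rw [hcub, hSz]; simp
    rw [hmul, neg_mul, neg_eq_zero] at this
    rw [star_mul, hNs, ← mul_assoc, this, zero_mul]
  have h5 : star N * N = 0 := by
    rw [hNs]; exact (CStarRing.star_mul_self_eq_zero_iff _).mp h4
  have h6 : N = 0 := (CStarRing.star_mul_self_eq_zero_iff _).mp h5
  refine CStarAlgebra.nonneg_iff_eq_star_mul_self.mp ?_
  rw [← hdec, h6, sub_zero]
  exact CFC.posPart_nonneg G

/-- positivity criterion for matrices -/
lemma aux_mat_pos {R : Type*} [CStarAlgebra R] [PartialOrder R] [StarOrderedRing R] {n : ℕ}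
    (G : CStarMatrix (Fin n) (Fin n) R) (hsa : IsSelfAdjoint G)
    (hG : ∀ p : Fin n → R, 0 ≤ ∑ i, ∑ j, star (p i) * G i j * p j) :
    ∃ H : CStarMatrix (Fin n) (Fin n) R, G = star H * H := by
  obtain ⟨N, S, hNs, hcub, hfin⟩ := aux_neg (B := CStarMatrix (Fin n) (Fin n) R) G hsa
  apply hfin
  ext l j
  refine aux_sum_zero (fun l => S l j) ?_ l
  have h1 := hG (fun i => N i j)
  have h2 : ∑ i, ∑ k, star (N i j) * G i k * N k j = (N * G * N) j j := by
    simp only [CStarMatrix.mul_apply, Finset.sum_mul]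
    rw [Finset.sum_comm]
    refine Finset.sum_congr rfl fun k _ => Finset.sum_congr rfl fun i _ => ?_
    have : star (N i j) = N j i := by
      conv_rhs => rw [← hNs]
      rfl
    rw [this]
  rw [h2, hcub] at h1
  have h3 : (-(star S * S)) j j = - ∑ l, star (S l j) * S l j := by
    simp [CStarMatrix.mul_apply, CStarMatrix.star_apply]
  rw [h3] at h1
  exact neg_nonneg.mp h1

lemma aux_bdd {P A : Type*} [CStarAlgebra P] [CStarAlgebra A] (E : A →ₗ[ℂ] P)
    (hpos : ∀ x : A, IsPosElem (E (star x * x))) :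
    (∃ C : ℝ, 0 ≤ C ∧ ∀ a, ‖E a‖ ≤ C * ‖a‖) ∧ ∀ a, E (star a) = star (E a) := by
  let _ := CStarAlgebra.spectralOrder P
  have _ := CStarAlgebra.spectralOrderedRing P
  let _ := CStarAlgebra.spectralOrder A
  have _ := CStarAlgebra.spectralOrderedRing A
  have hp : ∀ x : A, 0 ≤ x → 0 ≤ E x := by
    intro x hx
    obtain ⟨y, rfl⟩ := CStarAlgebra.nonneg_iff_eq_star_mul_self.mp hx
    exact CStarAlgebra.nonneg_iff_eq_star_mul_self.mpr (hpos y)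
  constructor
  · obtain ⟨C, hC⟩ := PositiveLinearMap.exists_norm_apply_le (PositiveLinearMap.mk₀ E hp)
    exact ⟨C, C.2, hC⟩
  · intro a
    obtain ⟨x, hx, -, ha⟩ := CStarAlgebra.exists_sum_four_nonneg a
    have h1 : ∀ i, star (x i) = x i := fun i => (IsSelfAdjoint.of_nonneg (hx i)).star_eq
    have h2 : ∀ i, star (E (x i)) = E (x i) :=
      fun i => (IsSelfAdjoint.of_nonneg (hp _ (hx i))).star_eq
    rw [ha]
    simp only [star_sum, star_smul, map_sum, map_smul, h1, h2]

/-- a quasi-basis can be chosen of the form `(u, u*)`, with the same index -/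
lemma aux_qb {P A : Type*} [CStarAlgebra P] [CStarAlgebra A]
    (ι : P →⋆ₐ[ℂ] A) (E : A →ₗ[ℂ] P) (hE : IsCondExpect ι E)
    (m : ℕ) (u v : Fin m → A) (hqb : IsQuasiBasis ι E u v) :
    ∃ s : Fin m → A, (∀ a, ∑ l, s l * ι (E (star (s l) * a)) = a) ∧
      (∀ a, ∑ l, ι (E (a * s l)) * star (s l) = a) ∧
      ∑ l, s l * star (s l) = ∑ i, u i * v i := by
  obtain ⟨-, hstar⟩ := aux_bdd E hE.pos
  let _ := CStarAlgebra.spectralOrder P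
  have _ := CStarAlgebra.spectralOrderedRing P
  have hl : ∀ p x, E (ι p * x) = p * E x := fun p x => by simpa using hE.bimodule p 1 x
  have hr : ∀ p x, E (x * ι p) = E x * p := fun p x => by simpa using hE.bimodule 1 p x
  obtain ⟨H, hH⟩ := aux_mat_pos (R := P) (n := m)
    (CStarMatrix.ofMatrix (Matrix.of fun i j => E (v i * star (v j))))
    (by
      ext i j
      change star (E (v j * star (v i))) = E (v i * star (v j))
      rw [← hstar]; simp)
    (by
      intro p
      have : ∑ i, ∑ j, star (p i) * (CStarMatrix.ofMatrix
          (Matrix.of fun i j => E (v i * star (v j)))) i j * p j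
          = E (star (star (∑ i, star (ι (p i)) * v i)) * star (∑ i, star (ι (p i)) * v i)) := by
        simp only [star_star, star_sum, star_mul, Finset.sum_mul, Finset.mul_sum, map_sum]
        rw [Finset.sum_comm]
        refine Finset.sum_congr rfl fun i _ => Finset.sum_congr rfl fun j _ => ?_
        have := hE.bimodule (star (p j)) (p i) (v j * star (v i))
        rw [map_star] at this
        change star (p j) * E (v j * star (v i)) * p i = _
        rw [← this]
        simp only [mul_assoc]
      rw [this]
      exact CStarAlgebra.nonneg_iff_eq_star_mul_self.mpr (hE.pos _))
  have hG : ∀ i j, E (v i * star (v j)) = ∑ l, star (H l i) * H l j := by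
    intro i j
    have := congrFun (congrFun hH i) j
    rw [CStarMatrix.mul_apply] at this
    exact this
  set s : Fin m → A := fun l => ∑ i, u i * star (ι (H l i)) with hs
  have hss : ∀ l, star (s l) = ∑ i, ι (H l i) * star (u i) := by
    intro l; simp [hs, star_sum]
  have hv : ∀ j, ∑ i, u i * ι (E (v i * star (v j))) = star (v j) := fun j => (hqb _).1.symm
  have hv2 : ∀ a, ∑ j, star (v j) * ι (E (star (u j) * a)) = a := by
    intro a
    have := congrArg star (hqb (star a)).2
    rw [star_star] at this
    conv_rhs => rw [this]
    rw [star_sum]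
    refine Finset.sum_congr rfl fun j _ => ?_
    rw [star_mul, ← map_star, ← hstar, star_mul, star_star]
  have h1 : ∀ a, ∑ l, s l * ι (E (star (s l) * a)) = a := by
    intro a
    calc ∑ l, s l * ι (E (star (s l) * a))
        = ∑ l, ∑ j, ∑ i, u i * (ι (star (H l i) * H l j) * ι (E (star (u j) * a))) := by
          refine Finset.sum_congr rfl fun l _ => ?_
          have hx : ι (E (star (s l) * a)) = ∑ j, ι (H l j) * ι (E (star (u j) * a)) := by
            rw [hss, Finset.sum_mul]
            simp only [map_sum, mul_assoc, hl, map_mul]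
          rw [hx, Finset.mul_sum]
          refine Finset.sum_congr rfl fun j _ => ?_
          simp only [hs, Finset.sum_mul]
          refine Finset.sum_congr rfl fun i _ => ?_
          simp only [map_mul, map_star, mul_assoc]
      _ = ∑ j, ∑ i, u i * ι (E (v i * star (v j))) * ι (E (star (u j) * a)) := by
          rw [Finset.sum_comm]
          refine Finset.sum_congr rfl fun j _ => ?_
          rw [Finset.sum_comm]
          refine Finset.sum_congr rfl fun i _ => ?_
          rw [hG, map_sum, mul_assoc, Finset.sum_mul, Finset.mul_sum]
      _ = a := by
          simp only [← Finset.sum_mul, hv, hv2]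
  have h2 : ∀ a, ∑ l, ι (E (a * s l)) * star (s l) = a := by
    intro a
    have := congrArg star (h1 (star a))
    rw [star_star, star_sum] at this
    conv_rhs => rw [← this]
    refine Finset.sum_congr rfl fun j _ => ?_
    rw [star_mul, ← map_star, ← hstar, star_mul, star_star, star_star]
  refine ⟨s, h1, h2, ?_⟩
  calc ∑ l, s l * star (s l)
      = ∑ l, ∑ i, u i * ι (E (v i * s l)) * star (s l) := by
        refine Finset.sum_congr rfl fun l _ => ?_
        rw [← Finset.sum_mul, ← (hqb (s l)).1]
    _ = ∑ i, u i * v i := by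
        rw [Finset.sum_comm]
        refine Finset.sum_congr rfl fun i _ => ?_
        conv_rhs => rw [← h2 (v i)]
        simp only [Finset.mul_sum, mul_assoc]

end Aux13
section Aux13b

/-- bounded sequences -/
def QBd {B : Type*} [NormedRing B] (f : ℕ → B) : Prop := ∃ M : ℝ, ∀ k, ‖f k‖ ≤ M

/-- equality in the sequence algebra -/
def QEq {B : Type*} [NormedRing B] (f g : ℕ → B) : Prop :=
  QBd f ∧ QBd g ∧ Tendsto (fun k => f k - g k) atTop (𝓝 0)

section
variable {B C : Type*} [NormedRing B] [NormedRing C] {f g f' g' h : ℕ → B}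

lemma QBd.const (b : B) : QBd (fun _ => b) := ⟨‖b‖, fun _ => le_rfl⟩

lemma QBd.mul (hf : QBd f) (hg : QBd g) : QBd (fun k => f k * g k) := by
  obtain ⟨M, hM⟩ := hf
  obtain ⟨N, hN⟩ := hg
  exact ⟨M * N, fun k => (norm_mul_le _ _).trans
    (mul_le_mul (hM k) (hN k) (norm_nonneg _) ((norm_nonneg _).trans (hM k)))⟩

lemma QBd.map (hf : QBd f) (T : B → C) (K : ℝ) (hK : 0 ≤ K) (hT : ∀ b, ‖T b‖ ≤ K * ‖b‖) :
    QBd (fun k => T (f k)) := by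
  obtain ⟨M, hM⟩ := hf
  exact ⟨K * M, fun k => (hT _).trans (mul_le_mul_of_nonneg_left (hM k) hK)⟩

lemma QEq.refl (hf : QBd f) : QEq f f := ⟨hf, hf, by simp⟩

lemma QEq.symm (h : QEq f g) : QEq g f := by
  refine ⟨h.2.1, h.1, ?_⟩
  simpa using h.2.2.neg

lemma QEq.trans (h1 : QEq f g) (h2 : QEq g h) : QEq f h := by
  refine ⟨h1.1, h2.2.1, ?_⟩
  simpa using h1.2.2.add h2.2.2

lemma QBd.mul_null (hf : QBd f) (hg : Tendsto g atTop (𝓝 0)) :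
    Tendsto (fun k => f k * g k) atTop (𝓝 0) := by
  obtain ⟨M, hM⟩ := hf
  refine squeeze_zero_norm (fun k => (norm_mul_le _ _).trans
    (mul_le_mul_of_nonneg_right (hM k) (norm_nonneg _))) ?_
  simpa using (hg.norm.const_mul M)

lemma QBd.null_mul (hf : QBd f) (hg : Tendsto g atTop (𝓝 0)) :
    Tendsto (fun k => g k * f k) atTop (𝓝 0) := by
  obtain ⟨M, hM⟩ := hf
  refine squeeze_zero_norm (fun k => (norm_mul_le _ _).trans
    (mul_le_mul_of_nonneg_left (hM k) (norm_nonneg _))) ?_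
  simpa using (hg.norm.mul_const M)

lemma QEq.mul (h1 : QEq f f') (h2 : QEq g g') :
    QEq (fun k => f k * g k) (fun k => f' k * g' k) := by
  refine ⟨h1.1.mul h2.1, h1.2.1.mul h2.2.1, ?_⟩
  have := (h2.1.null_mul h1.2.2).add (h1.2.1.mul_null h2.2.2)
  rw [add_zero] at this
  refine this.congr fun k => ?_
  noncomm_ring

lemma QEq.mul_left (hf : QBd f) (h2 : QEq g g') :
    QEq (fun k => f k * g k) (fun k => f k * g' k) := (QEq.refl hf).mul h2

lemma QEq.mul_right (hf : QBd f) (h2 : QEq g g') :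
    QEq (fun k => g k * f k) (fun k => g' k * f k) := h2.mul (QEq.refl hf)

lemma QEq.map [Module ℂ B] [Module ℂ C] (h1 : QEq f g) (T : B →ₗ[ℂ] C) (K : ℝ) (hK : 0 ≤ K)
    (hT : ∀ b, ‖T b‖ ≤ K * ‖b‖) : QEq (fun k => T (f k)) (fun k => T (g k)) := by
  refine ⟨h1.1.map T K hK hT, h1.2.1.map T K hK hT, ?_⟩
  refine squeeze_zero_norm (a := fun k => K * ‖f k - g k‖) (fun k => ?_) ?_
  · rw [← map_sub]; exact hT _
  · simpa using h1.2.2.norm.const_mul K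

end

variable {P A : Type*} [CStarAlgebra P] [CStarAlgebra A]

lemma aux_norm_sum {n : ℕ} (t : Fin n → A) (i : Fin n) :
    ‖t i‖ * ‖t i‖ ≤ ‖∑ l, t l * star (t l)‖ := by
  let _ := CStarAlgebra.spectralOrder A
  have _ := CStarAlgebra.spectralOrderedRing A
  rw [← CStarRing.norm_self_mul_star]
  refine CStarAlgebra.norm_le_norm_of_nonneg_of_le (mul_star_self_nonneg _) ?_
  exact Finset.single_le_sum (f := fun l => t l * star (t l))
      (fun i _ => mul_star_self_nonneg (t i)) (Finset.mem_univ i)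

/-- The Rokhlin projection yields an approximately multiplicative sequence of maps `A → P`. -/
lemma aux_beta (ι : P →⋆ₐ[ℂ] A) (E : A →ₗ[ℂ] P) (hE : IsCondExpect ι E)
    (m : ℕ) (u v : Fin m → A) (hqb : IsQuasiBasis ι E u v)
    (hRok : CondExpectHasRokhlin ι E (∑ i, u i * v i)) :
    ∃ (β : ℕ → A →ₗ[ℂ] P) (K : ℝ), (∀ k a, ‖β k a‖ ≤ K * ‖a‖) ∧
      (∀ p, Tendsto (fun k => β k (ι p)) atTop (𝓝 p)) ∧
      (∀ x p y, Tendsto (fun k => β k x * p * star (β k y) - β k (x * ι p * star y))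
        atTop (𝓝 0)) := by
  obtain ⟨⟨K, hK, hEb⟩, hstar⟩ := aux_bdd E hE.pos
  obtain ⟨s, hs1, hs2, hs3⟩ := aux_qb ι E hE m u v hqb
  obtain ⟨e, heb, hee, hes, hec, ⟨w, hwh, hhw, hwe⟩, -⟩ := hRok
  rw [← hs3] at hwh hhw
  have hl : ∀ p x, E (ι p * x) = p * E x := fun p x => by simpa using hE.bimodule p 1 x
  have hr : ∀ p x, E (x * ι p) = E x * p := fun p x => by simpa using hE.bimodule 1 p x
  have hιn : ∀ p, ‖ι p‖ ≤ 1 * ‖p‖ := fun p => by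
    rw [one_mul]; exact NonUnitalStarAlgHom.norm_apply_le ι p
  set h : A := ∑ l, s l * star (s l) with hh
  -- h is self-adjoint and central
  have hhs : star h = h := by simp [hh, star_sum]
  have hhc : ∀ a, h * a = a * h := by
    intro a
    calc h * a = ∑ j, ∑ i, s j * (ι (E (star (s j) * a * s i)) * star (s i)) := by
          rw [hh, Finset.sum_mul]
          refine Finset.sum_congr rfl fun j _ => ?_
          rw [← Finset.mul_sum, hs2, mul_assoc]
      _ = ∑ i, (∑ j, s j * ι (E (star (s j) * (a * s i)))) * star (s i) := by
          rw [Finset.sum_comm]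
          simp only [Finset.sum_mul, mul_assoc]
      _ = a * h := by
          simp only [hs1, hh, Finset.mul_sum, mul_assoc]
  -- basic asymptotics
  have E0 : ∀ {x : ℕ → A}, Tendsto (fun k => ‖x k‖) atTop (𝓝 0) → Tendsto x atTop (𝓝 0) :=
    fun hx => tendsto_zero_iff_norm_tendsto_zero.mpr hx
  have be : QBd e := heb
  have bc : ∀ a : A, QBd (fun _ : ℕ => a) := fun a => QBd.const a
  have q1 : QEq (fun k => e k * e k) e := ⟨be.mul be, be, E0 hee⟩
  have bs : QBd (fun k => star (e k)) := by
    obtain ⟨M, hM⟩ := heb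
    exact ⟨M, fun k => by rw [norm_star]; exact hM k⟩
  have q2 : QEq (fun k => star (e k)) e := ⟨bs, be, E0 hes⟩
  have q3 : ∀ a : A, QEq (fun k => e k * a) (fun k => a * e k) :=
    fun a => ⟨be.mul (bc a), (bc a).mul be, E0 (hec a)⟩
  have bE : ∀ {f : ℕ → A}, QBd f → QBd (fun k => E (f k)) := fun hf => hf.map E K hK hEb
  have bι : ∀ {f : ℕ → P}, QBd f → QBd (fun k => ι (f k)) :=
    fun hf => hf.map ι 1 zero_le_one hιn
  have qE : ∀ {f g : ℕ → A}, QEq f g → QEq (fun k => E (f k)) (fun k => E (g k)) :=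
    fun hf => hf.map E K hK hEb
  have qι : ∀ {f g : ℕ → P}, QEq f g → QEq (fun k => ι (f k)) (fun k => ι (g k)) :=
    fun hf => hf.map ι.toAlgHom.toLinearMap 1 zero_le_one hιn
  have q4 : QEq (fun k => ι (E (e k))) (fun _ => w) := ⟨bι (bE be), bc w, E0 hwe⟩
  -- w and h come from P
  have hwι : ι (E w) = w := by
    have h1 := qι (qE q4)
    have h2 : QEq (fun k => ι (E (e k))) (fun _ => ι (E w)) := by
      simpa only [hE.restricts] using h1
    have h3 := (h2.symm.trans q4).2.2
    exact sub_eq_zero.mp (tendsto_nhds_unique tendsto_const_nhds h3)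
  have hcw : E h * E w = 1 := by
    rw [← hr, hwι, hhw, ← map_one ι, hE.restricts]
  have hwc : E w * E h = 1 := by
    rw [← hl, hwι, hwh, ← map_one ι, hE.restricts]
  have hc : ι (E h) = h := by
    calc ι (E h) = h * w * ι (E h) := by rw [hhw, one_mul]
      _ = h * ι (E w * E h) := by rw [map_mul, hwι, mul_assoc]
      _ = h := by rw [hwc, map_one, mul_one]
  -- the main computation
  have hq : QEq (fun k => e k * h) (fun k => h * e k) := q3 h
  set t : ℕ → Fin m → A := fun k i => e k * s i - h * e k * ι (E (e k * s i)) with ht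
  have hsum : ∀ k, ∑ i, t k i * star (t k i) =
      (e k * h) * star (e k) - e k * star (e k) * star (e k) * h - h * (e k * e k) * star (e k)
        + h * e k * ι (E (e k * star (e k))) * star (e k) * h := by
    intro k
    have hst : ∀ i, star (t k i) =
        star (s i) * star (e k) - ι (E (star (s i) * star (e k))) * star (e k) * h := by
      intro i
      simp only [ht, star_sub, star_mul, hhs, ← map_star, ← hstar, mul_assoc]
    have e1 : ∑ i, s i * ι (E (star (s i) * star (e k))) = star (e k) := hs1 _
    have e2 : ∑ i, ι (E (e k * s i)) * star (s i) = e k := hs2 _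
    have e3 : ∑ i, ι (E (e k * s i)) * ι (E (star (s i) * star (e k)))
        = ι (E (e k * star (e k))) := by
      conv_rhs => rw [← e1, Finset.mul_sum, map_sum, map_sum]
      refine Finset.sum_congr rfl fun i _ => ?_
      rw [← mul_assoc, hr, map_mul ι]
    calc ∑ i, t k i * star (t k i)
        = ∑ i, (e k * (s i * star (s i)) * star (e k)
          - e k * (s i * ι (E (star (s i) * star (e k)))) * star (e k) * h
          - h * e k * (ι (E (e k * s i)) * star (s i)) * star (e k)
          + h * e k * (ι (E (e k * s i)) * ι (E (star (s i) * star (e k)))) * star (e k) * h) := by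
          refine Finset.sum_congr rfl fun i _ => ?_
          rw [hst]
          simp only [ht]
          noncomm_ring
      _ = _ := by
          rw [Finset.sum_add_distrib, Finset.sum_sub_distrib, Finset.sum_sub_distrib]
          simp only [← Finset.sum_mul, ← Finset.mul_sum]
          rw [e1, e2, e3, ← hh]
          simp only [mul_assoc]
  have c1 : QEq (fun k => (e k * h) * star (e k)) (fun k => h * e k) := by
    refine (hq.mul q2).trans ?_
    simp only [mul_assoc]
    exact QEq.mul_left (bc h) q1
  have c2 : QEq (fun k => e k * star (e k) * star (e k) * h) (fun k => h * e k) := by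
    have a1 := (((QEq.refl be).mul q2).trans q1).mul q2
    exact (QEq.mul_right (bc h) (a1.trans q1)).trans hq
  have c3 : QEq (fun k => h * (e k * e k) * star (e k)) (fun k => h * e k) := by
    refine ((QEq.mul_left (bc h) q1).mul q2).trans ?_
    simp only [mul_assoc]
    exact QEq.mul_left (bc h) q1
  have c4 : QEq (fun k => h * e k * ι (E (e k * star (e k))) * star (e k) * h)
      (fun k => h * e k) := by
    have a1 : QEq (fun k => ι (E (e k * star (e k)))) (fun _ => w) :=
      (qι (qE ((QEq.mul_left be q2).trans q1))).trans q4
    have a2 : QEq (fun k => h * e k * ι (E (e k * star (e k)))) e := by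
      have b1 := (QEq.mul_left ((bc h).mul be) a1)
      refine b1.trans ?_
      simp only [mul_assoc]
      refine (QEq.mul_left (bc h) (q3 w)).trans ?_
      simp only [← mul_assoc, hhw, one_mul]
      exact QEq.refl be
    exact (QEq.mul_right (bc h) ((a2.mul q2).trans q1)).trans hq
  have hlim : Tendsto (fun k => ∑ i, t k i * star (t k i)) atTop (𝓝 0) := by
    have := ((c1.2.2.sub c2.2.2).sub c3.2.2).add c4.2.2
    simp only [sub_zero, add_zero] at this
    refine this.congr fun k => ?_
    rw [hsum]
    abel
  have htl : ∀ i, Tendsto (fun k => t k i) atTop (𝓝 0) := by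
    intro i
    apply E0
    have h1 : Tendsto (fun k => ‖t k i‖ * ‖t k i‖) atTop (𝓝 0) :=
      squeeze_zero (fun k => mul_self_nonneg _) (fun k => aux_norm_sum (t k) i)
        (by simpa using hlim.norm)
    have h2 := h1.sqrt
    simpa [Real.sqrt_mul_self] using h2
  have hD : ∀ a, QEq (fun k => e k * a) (fun k => h * e k * ι (E (e k * a))) := by
    intro a
    refine ⟨be.mul (bc a), ((bc h).mul be).mul (bι (bE (be.mul (bc a)))), ?_⟩
    have h1 : Tendsto (fun k => ∑ i, t k i * ι (E (star (s i) * a))) atTop (𝓝 0) := by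
      have := tendsto_finsetSum (Finset.univ : Finset (Fin m))
        (fun i _ => (htl i).mul_const (ι (E (star (s i) * a))))
      simpa using this
    refine h1.congr fun k => ?_
    have e1 := hs1 a
    have e3 : ∑ i, ι (E (e k * s i)) * ι (E (star (s i) * a)) = ι (E (e k * a)) := by
      conv_rhs => rw [← e1, Finset.mul_sum, map_sum, map_sum]
      refine Finset.sum_congr rfl fun i _ => ?_
      rw [← mul_assoc, hr, map_mul ι]
    simp only [ht, sub_mul, Finset.sum_sub_distrib, mul_assoc, ← Finset.mul_sum]
    rw [e1, e3]
  -- the maps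
  let β : ℕ → A →ₗ[ℂ] P := fun k =>
    (LinearMap.mulLeft ℂ (E h)) ∘ₗ E ∘ₗ (LinearMap.mulLeft ℂ (e k))
  have hβ : ∀ k a, β k a = E h * E (e k * a) := fun k a => rfl
  have bβ : ∀ a, QBd (fun k => β k a) := fun a => (QBd.const (E h)).mul (bE (be.mul (bc a)))
  have hDβ : ∀ a, QEq (fun k => e k * a) (fun k => e k * ι (β k a)) := by
    intro a
    refine (hD a).trans ?_
    have := QEq.mul_right (bι (bE (be.mul (bc a)))) hq.symm
    simpa only [hβ, map_mul, hc, mul_assoc] using this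
  have hmul : ∀ x y, QEq (fun k => β k (x * y)) (fun k => β k x * β k y) := by
    intro x y
    have a1 : QEq (fun k => e k * (x * y)) (fun k => e k * x * ι (β k y)) := by
      have b1 := QEq.mul_right (bc y) (q3 x)
      have b2 := QEq.mul_left (bc x) (hDβ y)
      have b3 := QEq.mul_right (bι (bβ y)) (q3 x)
      simp only [mul_assoc] at b1 b2 b3 ⊢
      exact b1.trans (b2.trans b3.symm)
    have a2 := QEq.mul_left (QBd.const (E h)) (qE a1)
    simp only [hr] at a2
    simpa only [hβ, mul_assoc] using a2
  have hst : ∀ y, QEq (fun k => β k (star y)) (fun k => star (β k y)) := by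
    intro y
    have a1 : QEq (fun k => star y * star (e k)) (fun k => e k * star y) :=
      (QEq.mul_left (bc _) q2).trans (q3 _).symm
    have a2 : QEq (fun k => E (star y * star (e k)) * E h) (fun k => E (e k * star y) * E h) :=
      QEq.mul_right (QBd.const _) (qE a1)
    have a3 : ∀ k, star (β k y) = E (star y * star (e k)) * E h := by
      intro k
      rw [hβ, star_mul, ← hstar, ← hstar, hhs, star_mul]
    have a4 : ∀ k, β k (star y) = E (e k * star y) * E h := by
      intro k
      rw [hβ, ← hl, ← hr, hc, hhc]
    simp only [a3, a4]
    exact a2.symm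
  obtain ⟨M, hM⟩ := heb
  refine ⟨β, ‖E h‖ * (K * M), ?_, ?_, ?_⟩
  · intro k a
    rw [hβ]
    have h1 : ‖e k * a‖ ≤ M * ‖a‖ :=
      (norm_mul_le _ _).trans (mul_le_mul_of_nonneg_right (hM k) (norm_nonneg _))
    calc ‖E h * E (e k * a)‖ ≤ ‖E h‖ * ‖E (e k * a)‖ := norm_mul_le _ _
      _ ≤ ‖E h‖ * (K * (M * ‖a‖)) := by
          gcongr
          exact (hEb _).trans (by gcongr)
      _ = _ := by ring
  · intro p
    have h1 : Tendsto (fun k => E (e k)) atTop (𝓝 (E w)) := by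
      have := (qE q4).2.2
      simp only [hE.restricts] at this
      exact tendsto_sub_nhds_zero_iff.mp this
    have h2 := (h1.const_mul (E h)).mul_const p
    rw [hcw, one_mul] at h2
    refine h2.congr fun k => ?_
    rw [hβ, hr, mul_assoc]
  · intro x p y
    have a1 := (hmul (x * ι p) (star y)).trans (QEq.mul_left (bβ _) (hst y))
    have a2 : ∀ k, β k (x * ι p) = β k x * p := by
      intro k
      rw [hβ, hβ, ← mul_assoc, hr, mul_assoc]
    simp only [a2] at a1
    exact a1.symm.2.2

end Aux13b

theorem stmt13 (P A : Type) [CStarAlgebra P] [CStarAlgebra A]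
    (hexact : IsExactCStar A) (hA : HasStrictComparison A)
    (ι : P →⋆ₐ[ℂ] A) (hι : Function.Injective ι)
    (E : A →ₗ[ℂ] P) (hE : IsCondExpect ι E)
    (m : ℕ) (u v : Fin m → A) (hqb : IsQuasiBasis ι E u v)
    (hRok : CondExpectHasRokhlin ι E (∑ i, u i * v i)) :
    HasStrictComparison P := by
  intro n l a b ha hb hab
  obtain ⟨x, hx⟩ := hA n l (a.map ι) (b.map ι) (aux_map_pos ι a ha) (aux_map_pos ι b hb)
    (fun σ hσ => by
      rw [aux_dimFun ι a ha, aux_dimFun ι b hb]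
      exact hab _ (aux_tracial ι σ hσ))
  obtain ⟨β, K, hβK, hβι, hβm⟩ := aux_beta ι E hE m u v hqb hRok
  -- for each fixed `j`, the images converge entrywise to within the error
  have hfix : ∀ j i i', Tendsto (fun k =>
      ((x j).map (β k) * b * ((x j).map (β k)).conjTranspose) i i'
        - β k ((x j * b.map ι * (x j).conjTranspose) i i')) atTop (𝓝 0) := by
    intro j i i'
    have h1 := tendsto_finsetSum (Finset.univ : Finset (Fin l)) (fun q _ =>
      tendsto_finsetSum (Finset.univ : Finset (Fin l)) (fun p _ =>
        hβm (x j i p) (b p q) (x j i' q)))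
    simp only [Finset.sum_const_zero] at h1
    refine h1.congr fun k => ?_
    simp only [Matrix.mul_apply, Matrix.map_apply, Matrix.conjTranspose_apply, Finset.sum_mul,
      map_sum, Finset.sum_sub_distrib]
  have hmain : ∀ N : ℕ, ∃ y : Matrix (Fin n) (Fin l) P, ∀ i i',
      ‖(y * b * y.conjTranspose) i i' - a i i'‖ < 1 / ((N : ℝ) + 1) := by
    intro N
    set ε : ℝ := 1 / ((N : ℝ) + 1) with hε
    have hε0 : 0 < ε := by positivity
    have hj : ∀ᶠ j in atTop, ∀ i i',
        |K| * ‖(x j * b.map ι * (x j).conjTranspose) i i' - ι (a i i')‖ < ε / 3 := by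
      rw [eventually_all]; intro i
      rw [eventually_all]; intro i'
      have h1 : Tendsto (fun j => (x j * b.map ι * (x j).conjTranspose) i i') atTop
          (𝓝 (ι (a i i'))) := by
        have := tendsto_pi_nhds.mp (tendsto_pi_nhds.mp hx i) i'
        exact this
      have h2 := (tendsto_sub_nhds_zero_iff.mpr h1).norm.const_mul |K|
      rw [norm_zero, mul_zero] at h2
      exact h2.eventually_lt_const (by positivity)
    obtain ⟨j, hj⟩ := hj.exists
    have hk : ∀ᶠ k in atTop, ∀ i i',
        ‖((x j).map (β k) * b * ((x j).map (β k)).conjTranspose) i i'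
        - β k ((x j * b.map ι * (x j).conjTranspose) i i')‖ < ε / 3 ∧
        ‖β k (ι (a i i')) - a i i'‖ < ε / 3 := by
      rw [eventually_all]; intro i
      rw [eventually_all]; intro i'
      have h1 := (hfix j i i').norm
      have h2 := (tendsto_sub_nhds_zero_iff.mpr (hβι (a i i'))).norm
      rw [norm_zero] at h1 h2
      exact (h1.eventually_lt_const (by positivity)).and (h2.eventually_lt_const (by positivity))
    obtain ⟨k, hk⟩ := hk.exists
    refine ⟨(x j).map (β k), fun i i' => ?_⟩
    obtain ⟨h1, h2⟩ := hk i i'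
    have h3 := hj i i'
    set z := (x j * b.map ι * (x j).conjTranspose) i i'
    have h4 : ‖β k z - β k (ι (a i i'))‖ < ε / 3 := by
      rw [← map_sub]
      refine lt_of_le_of_lt ((hβK k _).trans ?_) h3
      exact mul_le_mul_of_nonneg_right (le_abs_self K) (norm_nonneg _)
    set Y := ((x j).map (β k) * b * ((x j).map (β k)).conjTranspose) i i'
    calc ‖Y - a i i'‖ = ‖(Y - β k z) + (β k z - β k (ι (a i i')))
          + (β k (ι (a i i')) - a i i')‖ := by congr 1; abel
      _ ≤ ‖Y - β k z‖ + ‖β k z - β k (ι (a i i'))‖ + ‖β k (ι (a i i')) - a i i'‖ :=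
          norm_add₃_le
      _ < ε := by linarith
  choose y hy using hmain
  refine ⟨y, ?_⟩
  refine tendsto_pi_nhds.mpr fun i => tendsto_pi_nhds.mpr fun i' => ?_
  refine tendsto_sub_nhds_zero_iff.mp ?_
  exact squeeze_zero_norm (fun N => (hy N i i').le) tendsto_one_div_add_atTop_nhds_zero_nat

end
end
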